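/- arXiv:math/0508370 — 4 statements merged into one kernel-verified Lean document; each statement's English description precedes it below -/
import Mathlib

section
/- Let G be a group with a normal subgroup H, and suppose H is the internal semidirect product of a free subgroup F by a finite subgroup C (that is, F is a normal subgroup of H, F is a free group, C is a finite subgroup of H, F ∩ C = {1} and F·C = H), and suppose that the quotient group G/H is left orderable. Then every torsion subgroup of G embeds in C: for every subgroup T of G all of whose elements have finite order, there exists an injective group homomorphism from T into C. -/
/-- A group `Q` is left orderable if there is a linear order on `Q`
invariant under left multiplication. -/
def IsLeftOrderable (Q : Type) [Group Q] : Prop :=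
  ∃ (_ : LinearOrder Q), ∀ g x y : Q, x ≤ y → g * x ≤ g * y

theorem IsLeftOrderable.eq_one_of_isOfFinOrder {Q : Type} [Group Q]
    (hQ : IsLeftOrderable Q) {x : Q} (hx : IsOfFinOrder x) : x = 1 := by
  obtain ⟨_, hmul⟩ := hQ
  have : MulLeftMono Q := ⟨hmul⟩
  obtain ⟨n, hn, hxn⟩ := isOfFinOrder_iff_pow_eq_one.mp hx
  rcases lt_trichotomy x 1 with hlt | heq | hgt
  · exact absurd hxn (pow_lt_one' hlt hn.ne').ne
  · exact heq
  · exact absurd hxn (one_lt_pow' hgt hn.ne').ne'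

theorem IsFreeGroup.isMulTorsionFree {G : Type*} [Group G] (hG : IsFreeGroup G) :
    IsMulTorsionFree G :=
  Function.Injective.isMulTorsionFree (IsFreeGroup.toFreeGroup G).toMonoidHom
    (IsFreeGroup.toFreeGroup G).injective

/-- If `H` is a normal subgroup of `G` which is the internal
semidirect product of a free subgroup `F` by a finite subgroup `C`, and `G/H`
is left orderable, then every torsion subgroup of `G` embeds in `C`. -/
theorem torsion_subgroup_embeds_of_semidirect
    (G : Type) [Group G] (H : Subgroup G) [H.Normal]
    (F C : Subgroup ↥H) (hFnormal : F.Normal) (hFfree : IsFreeGroup ↥F)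
    (hCfin : Finite ↥C) (hFC_inf : F ⊓ C = ⊥) (hFC_sup : F ⊔ C = ⊤)
    (hLO : IsLeftOrderable (G ⧸ H))
    (T : Subgroup G) (hT : ∀ x ∈ T, IsOfFinOrder x) :
    ∃ f : ↥T →* ↥C, Function.Injective f := by
  have hTH : T ≤ H := fun x hx ↦ (QuotientGroup.eq_one_iff x).mp <|
    hLO.eq_one_of_isOfFinOrder ((QuotientGroup.mk' H).isOfFinOrder (hT x hx))
  have hcompl : C.IsComplement' F := by
    refine Subgroup.isComplement'_of_disjoint_and_mul_eq_univ
      (disjoint_iff.mpr (inf_comm F C ▸ hFC_inf)) ?_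
    rw [← Subgroup.mul_normal, sup_comm, hFC_sup, Subgroup.coe_top]
  have : IsMulTorsionFree ↥F := hFfree.isMulTorsionFree
  refine ⟨hcompl.QuotientMulEquiv.toMonoidHom.comp
    ((QuotientGroup.mk' F).comp (Subgroup.inclusion hTH)),
    hcompl.QuotientMulEquiv.injective.comp ?_⟩
  refine (injective_iff_map_eq_one
    ((QuotientGroup.mk' F).comp (Subgroup.inclusion hTH))).mpr fun x hx ↦ ?_
  have hxF : Subgroup.inclusion hTH x ∈ F := (QuotientGroup.eq_one_iff _).mp hx
  have hfin : IsOfFinOrder (⟨Subgroup.inclusion hTH x, hxF⟩ : ↥F) := by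
    rw [← F.subtype_injective.isOfFinOrder_iff, ← H.subtype_injective.isOfFinOrder_iff]
    exact hT x x.2
  exact Subgroup.inclusion_injective hTH
    ((congrArg Subtype.val hfin.eq_one').trans (map_one _).symm)
end

section
/- Let X be a set, F the free group on X, and q a nontrivial element of F that is not a proper power (i.e., whenever q = y^k with k a positive integer and y ∈ F, then k = 1). Let m be a positive integer, let G = F/⟪q^m⟫ be the one-relator group with relator q^m, let c be the image of q in G, let C = ⟨c⟩ be the cyclic subgroup generated by c, and let H be the normal closure of c in G. Then C has order m, and H has a normal free subgroup K with K ∩ C = {1} and K·C = H; that is, H is the internal semidirect product K ⋊ C of a free group K by the finite cyclic group C of order m. -/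
open Monoid

theorem Subgroup.normalClosure_one {G : Type*} [Group G] :
    Subgroup.normalClosure {(1 : G)} = ⊥ :=
  le_bot_iff.1 (Subgroup.normalClosure_le_normal (by simp))

theorem Subgroup.normalClosure_le_of_mem {G : Type*} [Group G] {c : G} {N : Subgroup G} [N.Normal]
    (h : c ∈ N) : Subgroup.normalClosure {c} ≤ N :=
  Subgroup.normalClosure_le_normal (Set.singleton_subset_iff.2 h)

theorem Subgroup.self_mem_normalClosure {G : Type*} [Group G] (c : G) :
    c ∈ Subgroup.normalClosure {c} :=
  Subgroup.subset_normalClosure (Set.mem_singleton c)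

theorem Subgroup.normalClosure_eq_of_isConj {G : Type*} [Group G] {c d : G} (h : IsConj c d) :
    Subgroup.normalClosure {c} = Subgroup.normalClosure {d} := by
  refine le_antisymm (normalClosure_le_of_mem ?_) (normalClosure_le_of_mem ?_)
  · obtain ⟨b, rfl⟩ := isConj_iff.1 h.symm
    exact normalClosure_normal.conj_mem _ (self_mem_normalClosure d) b
  · obtain ⟨b, rfl⟩ := isConj_iff.1 h
    exact normalClosure_normal.conj_mem _ (self_mem_normalClosure c) b

theorem exists_injective_hom_of_cocycle {E Ω D : Type*} [Group E] [MulAction E Ω] [Group D]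
    (ρ : E →* Function.End (Ω × D)) (T : Ω → E) (b : D →* E) (S : Set E)
    (hS : ∀ e, e ∈ Submonoid.closure S)
    (hfst : ∀ e ∈ S, ∀ w d, (ρ e (w, d)).1 = e • w)
    (hmul : ∀ e ∈ S, ∀ w d d', (ρ e (w, d * d')).2 = (ρ e (w, d)).2 * d')
    (hT : ∀ e ∈ S, ∀ w d, T (ρ e (w, d)).1 * b (ρ e (w, d)).2 = e * (T w * b d))
    (ω : Ω) (N : Subgroup E) (hN : ∀ n ∈ N, ∀ w : Ω, n • w = w) :
    ∃ ν : N →* D, Function.Injective ν ∧ (∀ n : N, ν n = (ρ n (ω, 1)).2) ∧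
      (∀ e w d, (ρ e (w, d)).1 = e • w) ∧
      ∀ e w d d', (ρ e (w, d * d')).2 = (ρ e (w, d)).2 * d' := by
  have hρ : ∀ e f p, ρ (e * f) p = ρ e (ρ f p) := by
    intro e f p; rw [map_mul]; rfl
  have hall : ∀ e, (∀ w d, (ρ e (w, d)).1 = e • w) ∧
      (∀ w d d', (ρ e (w, d * d')).2 = (ρ e (w, d)).2 * d') ∧
      ∀ w d, T (ρ e (w, d)).1 * b (ρ e (w, d)).2 = e * (T w * b d) := by
    intro e
    induction hS e using Submonoid.closure_induction with
    | mem e he => exact ⟨hfst e he, hmul e he, hT e he⟩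
    | one =>
      rw [map_one]
      exact ⟨fun w d => (one_smul E w).symm, fun _ _ _ => rfl, fun w d => (one_mul _).symm⟩
    | mul x y _ _ hx hy =>
      obtain ⟨hx1, hx2, hx3⟩ := hx
      obtain ⟨hy1, hy2, hy3⟩ := hy
      refine ⟨fun w d => ?_, fun w d d' => ?_, fun w d => ?_⟩
      · rw [hρ, mul_smul, ← hy1 w d]
        exact hx1 _ _
      · have : ρ y (w, d * d') = ((ρ y (w, d)).1, (ρ y (w, d)).2 * d') :=
          Prod.ext ((hy1 _ _).trans (hy1 _ _).symm) (hy2 _ _ _)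
        rw [hρ, hρ, this]
        exact hx2 _ _ _
      · rw [hρ, mul_assoc, ← hy3]
        exact hx3 _ _
  replace hfst := fun e => (hall e).1
  replace hmul := fun e => (hall e).2.1
  replace hT := fun e => (hall e).2.2
  refine ⟨MonoidHom.mk' (fun n => (ρ n (ω, 1)).2) ?_, ?_, fun n => rfl, hfst, hmul⟩
  · intro a c
    have h1 : ρ (a * c : E) (ω, 1) = ρ a (ρ c (ω, 1)) := by rw [map_mul]; rfl
    have h2 : ρ (c : E) (ω, 1) = (ω, 1 * (ρ (c : E) (ω, 1)).2) := by
      refine Prod.ext ?_ (one_mul _).symm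
      rw [hfst, hN _ c.2]
    change (ρ (a * c : E) (ω, 1)).2 = _
    rw [h1, h2, hmul, one_mul]
  · intro a c hac
    have key : ∀ n : N, (n : E) = T ω * b (ρ n (ω, 1)).2 * (T ω)⁻¹ := by
      intro n
      have := hT n ω 1
      rw [hfst, hN _ n.2] at this
      rw [this]; simp
    apply Subtype.ext
    rw [key a, key c]
    change (ρ a (ω, 1)).2 = (ρ c (ω, 1)).2 at hac
    rw [hac]

/-- A map that is equivariant up to the kernel -/
theorem exists_equivariant_section {M C : Type*} [Group M] [Group C] (φ : M →* C) :
    ∃ s : C → M, ∀ k i, φ (s (φ k * i)) = φ k * φ (s i) := by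
  classical
  have : ∀ i : C, ∃ k : M, φ k * (Quotient.out (Quotient.mk (QuotientGroup.rightRel φ.range) i)) = i := by
    intro i
    have h : (QuotientGroup.rightRel φ.range).r (Quotient.out (Quotient.mk (QuotientGroup.rightRel φ.range) i)) i :=
      Quotient.mk_out (s := QuotientGroup.rightRel φ.range) i
    have h' := QuotientGroup.rightRel_apply.1 h
    obtain ⟨k, hk⟩ := h'
    exact ⟨k, by rw [hk]; simp⟩
  choose s hs using this
  refine ⟨s, fun k i => ?_⟩
  have h1 := hs i
  have h2 := hs (φ k * i)
  have h3 : (Quotient.mk (QuotientGroup.rightRel φ.range) (φ k * i)) = Quotient.mk (QuotientGroup.rightRel φ.range) i := by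
    apply Quotient.sound
    apply QuotientGroup.rightRel_apply.2
    exact ⟨k⁻¹, by simp⟩
  rw [h3] at h2
  rw [← eq_mul_inv_iff_mul_eq] at h1 h2
  rw [h1, h2, mul_assoc]

theorem isFreeGroup_ker_lift {J : Type} {M : J → Type} [∀ j, Group (M j)] {C : Type} [Group C]
    (χ : ∀ j, M j →* C) (hfree : ∀ j, IsFreeGroup (χ j).ker) :
    IsFreeGroup (CoprodI.lift χ).ker := by
  classical
  choose s hs using fun j => exists_equivariant_section (χ j)
  have hk : ∀ j k i, (s j (χ j k * i))⁻¹ * k * s j i ∈ (χ j).ker := by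
    intro j k i
    rw [MonoidHom.mem_ker]
    simp [hs]
  obtain ⟨L, _, _, z, inc, b, hbz, hb⟩ : ∃ (L : Type) (_ : Group L) (_ : IsFreeGroup L)
      (z : J → C → L) (inc : ∀ j, (χ j).ker →* L) (b : L →* CoprodI M),
      (∀ j i, b (z j i) = CoprodI.of (s j i)) ∧
      ∀ j (x : (χ j).ker), b (inc j x) = CoprodI.of (x : M j) := by
    refine ⟨FreeGroup ((J × C) ⊕ (Σ j, IsFreeGroup.Generators (χ j).ker)), inferInstance,
      inferInstance, fun j i => FreeGroup.of (Sum.inl (j, i)),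
      fun j => IsFreeGroup.lift fun x => FreeGroup.of (Sum.inr ⟨j, x⟩),
      FreeGroup.lift (Sum.elim (fun p => CoprodI.of (s p.1 p.2))
        fun p => CoprodI.of ((IsFreeGroup.of p.2 : (χ p.1).ker) : M p.1)), ?_, ?_⟩
    · simp
    · intro j x
      have h : (FreeGroup.lift (Sum.elim (fun p : J × C => CoprodI.of (s p.1 p.2))
            fun p : Σ j, IsFreeGroup.Generators (χ j).ker =>
              CoprodI.of ((IsFreeGroup.of p.2 : (χ p.1).ker) : M p.1))).comp
          (IsFreeGroup.lift fun x : IsFreeGroup.Generators (χ j).ker =>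
            FreeGroup.of (Sum.inr (Sigma.mk j x))) =
          (CoprodI.of (M := M) (i := j)).comp (χ j).ker.subtype :=
        IsFreeGroup.ext_hom fun a => by simp
      exact DFunLike.congr_fun h x
  let κ : ∀ j, M j → C → L := fun j k i => inc j ⟨_, hk j k i⟩
  have hκ1 : ∀ j i, κ j 1 i = 1 := fun j i => by
    rw [← map_one (inc j)]
    exact congrArg _ (Subtype.ext (by simp))
  have hκm : ∀ j k l i, κ j (k * l) i = κ j k (χ j l * i) * κ j l i := fun j k l i => by
    change inc j _ = inc j _ * inc j _
    rw [← map_mul]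
    exact congrArg _ (Subtype.ext (by simp [mul_assoc]))
  have hbκ : ∀ j k i, b (z j (χ j k * i) * κ j k i * (z j i)⁻¹) = CoprodI.of k := fun j k i => by
    simp only [κ, hb, hbz, map_mul, map_inv]
    group
  let act : ∀ j, M j →* Function.End (C × L) := fun j =>
    { toFun := fun k p => (χ j k * p.1, z j (χ j k * p.1) * κ j k p.1 * (z j p.1)⁻¹ * p.2)
      map_one' := by
        funext p
        exact Prod.ext (by simp; rfl) (by simp [hκ1]; rfl)
      map_mul' := fun k l => by
        funext p
        refine Prod.ext ?_ ?_
        · change χ j (k * l) * p.1 = χ j k * (χ j l * p.1)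
          simp [mul_assoc]
        · change _ = z j (χ j k * (χ j l * p.1)) * κ j k (χ j l * p.1) * (z j (χ j l * p.1))⁻¹ *
            (z j (χ j l * p.1) * κ j l p.1 * (z j p.1)⁻¹ * p.2)
          simp [hκm, mul_assoc] }
  let ρ : CoprodI M →* Function.End (C × L) := CoprodI.lift act
  have hρ : ∀ j k p, ρ (CoprodI.of (i := j) k) p =
      (χ j k * p.1, z j (χ j k * p.1) * κ j k p.1 * (z j p.1)⁻¹ * p.2) := by
    intro j k p
    simp only [ρ, CoprodI.lift_of]; rfl
  let _ : MulAction (CoprodI M) C := MulAction.compHom C (CoprodI.lift χ)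
  have hsm : ∀ (e : CoprodI M) (c : C), e • c = CoprodI.lift χ e * c := fun _ _ => rfl
  have hS : ∀ e : CoprodI M,
      e ∈ Submonoid.closure {e | ∃ j, ∃ k : M j, e = CoprodI.of k} := by
    intro e
    induction e using CoprodI.induction_on with
    | one => exact one_mem _
    | of j k => exact Submonoid.subset_closure ⟨j, k, rfl⟩
    | mul x y hx hy => exact mul_mem hx hy
  obtain ⟨ν, hν, -⟩ := exists_injective_hom_of_cocycle ρ (b := b) (fun _ => 1) _ hS
    (by
      rintro _ ⟨j, k, rfl⟩ w d
      rw [hρ, hsm, CoprodI.lift_of])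
    (by
      rintro _ ⟨j, k, rfl⟩ w d d'
      rw [hρ, hρ]; simp [mul_assoc])
    (by
      rintro _ ⟨j, k, rfl⟩ w d
      rw [hρ, map_mul, hbκ]; simp)
    1 (CoprodI.lift χ).ker
    (by
      intro n hn w
      rw [hsm, (MonoidHom.mem_ker).1 hn, one_mul])
  exact IsFreeGroup.ofMulEquiv (MonoidHom.ofInjective hν).symm

theorem exists_amalgam_section {H A B : Type*} [Group H] [Group A] [Group B]
    (φ : H →* A) (ψ : A →* B) (hψ : Function.Surjective ψ)
    (hinj : Function.Injective (ψ.comp φ)) (t : Set B) (h1 : (1 : B) ∈ t)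
    (ht : Subgroup.IsComplement ((ψ.comp φ).range : Set B) t) :
    ∃ σ : B → A, (∀ x, ψ (σ x) = x) ∧ σ 1 = 1 ∧ ∀ h x, σ (ψ (φ h) * x) = φ h * σ x := by
  classical
  obtain ⟨s, hs, hs1⟩ : ∃ s : B → A, (∀ x, ψ (s x) = x) ∧ s 1 = 1 := by
    obtain ⟨s, hs⟩ := hψ.hasRightInverse
    refine ⟨fun x => if x = 1 then 1 else s x, fun x => ?_, by simp⟩
    by_cases hx : x = 1
    · simp [hx]
    · simpa [hx] using hs x
  refine ⟨fun x => φ ((MonoidHom.ofInjective hinj).symm (ht.equiv x).1) * s (ht.equiv x).2,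
    fun x => ?_, ?_, fun h x => ?_⟩
  · have h2 : ψ (φ ((MonoidHom.ofInjective hinj).symm (ht.equiv x).1)) = (ht.equiv x).1 :=
      MonoidHom.apply_ofInjective_symm hinj _
    rw [map_mul, h2, hs]
    exact ht.equiv_fst_mul_equiv_snd x
  · beta_reduce
    rw [ht.equiv_one (one_mem _) h1]
    have : (MonoidHom.ofInjective hinj).symm ⟨1, one_mem _⟩ = 1 := map_one _
    rw [this]
    simp [hs1]
  · have h2 := ht.equiv_mul_left ⟨ψ (φ h), ⟨h, rfl⟩⟩ x
    change ht.equiv (ψ (φ h) * x) = _ at h2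
    beta_reduce
    rw [h2]
    have h3 : (MonoidHom.ofInjective hinj).symm ⟨ψ (φ h), ⟨h, rfl⟩⟩ = h :=
      (MulEquiv.symm_apply_eq _).2 rfl
    simp only [map_mul, h3, mul_assoc]

theorem CoprodI.Word.prod_map_rcons {ι : Type*} {M : ι → Type*} [∀ i, Group (M i)]
    [DecidableEq ι] [∀ i, DecidableEq (M i)] {E : Type*} [Monoid E]
    (f : (Σ i, M i) → E) (hf : ∀ i, f ⟨i, 1⟩ = 1) {i : ι} (p : CoprodI.Word.Pair M i) :
    ((CoprodI.Word.rcons p).toList.map f).prod = f ⟨i, p.head⟩ * (p.tail.toList.map f).prod := by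
  by_cases h : p.head = 1
  · simp [CoprodI.Word.rcons, h, hf]
  · simp [CoprodI.Word.rcons, h]

theorem exists_injective_hom_ker_pushout {ι H C : Type} {A B : ι → Type} [Group H] [CommGroup C]
    [∀ i, Group (A i)] [∀ i, Group (B i)] (φ : ∀ i, H →* A i) (ψ : ∀ i, A i →* B i)
    (hψ : ∀ i, Function.Surjective (ψ i)) (hinj : ∀ i, Function.Injective ((ψ i).comp (φ i)))
    (χ : ∀ i, (ψ i).ker →* C)
    (hχ : ∀ i (a : A i) (m m' : (ψ i).ker), (m' : A i) = a⁻¹ * m * a → χ i m' = χ i m)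
    (π : PushoutI φ →* PushoutI fun i => (ψ i).comp (φ i))
    (hπ : ∀ i a, π (PushoutI.of i a) = PushoutI.of i (ψ i a)) (hπb : ∀ h, π (PushoutI.base φ h) =
      PushoutI.base _ h) :
    ∃ (J : Type) (idx : J → ι) (ν : π.ker →* CoprodI fun j => (ψ (idx j)).ker),
      Function.Injective ν ∧ ∀ i (m : (ψ i).ker) (n : π.ker),
        IsConj (PushoutI.of i (m : A i)) (n : PushoutI φ) →
        CoprodI.lift (fun j => χ (idx j)) (ν n) = χ i m := by
  classical
  obtain ⟨d⟩ := PushoutI.NormalWord.transversal_nonempty (fun i => (ψ i).comp (φ i)) hinj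
  choose σ hσ hσ1 hσφ using fun i => exists_amalgam_section (φ i) (ψ i) (hψ i) (hinj i) (d.set i)
    (d.one_mem i) (d.compl i)
  let Ω := PushoutI.NormalWord d
  let J := ι × CoprodI.Word B
  let D := CoprodI fun j : J => (ψ j.1).ker
  let κ : ∀ i, CoprodI.Word B → (ψ i).ker →* D := fun i t =>
    CoprodI.of (M := fun j : J => (ψ j.1).ker) (i := (i, t))
  have hc : ∀ i (a : A i) (x : B i), (σ i (ψ i a * x))⁻¹ * a * σ i x ∈ (ψ i).ker := by
    intro i a x
    rw [MonoidHom.mem_ker]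
    simp [hσ]
  let cc : ∀ i, A i → B i → (ψ i).ker := fun i a x => ⟨_, hc i a x⟩
  have hcc1 : ∀ i x, cc i 1 x = 1 := fun i x => Subtype.ext (by simp [cc])
  have hccm : ∀ i a a' x, cc i (a * a') x = cc i a (ψ i a' * x) * cc i a' x := fun i a a' x =>
    Subtype.ext (by simp [cc, mul_assoc])
  have hccφ : ∀ i h x, cc i (φ i h) x = 1 := fun i h x => Subtype.ext (by simp [cc, hσφ])
  have hpair : ∀ i (g : B i) (w : Ω), PushoutI.NormalWord.equivPair i (g • w) =
      { PushoutI.NormalWord.equivPair i w with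
        head := g * (PushoutI.NormalWord.equivPair i w).head } := by
    intro i g w
    rw [PushoutI.NormalWord.summand_smul_def']
    exact Equiv.apply_symm_apply _ _
  let act : ∀ i, A i →* Function.End (Ω × D) := fun i =>
    { toFun := fun a p => (ψ i a • p.1, κ i (PushoutI.NormalWord.equivPair i p.1).tail
        (cc i a (PushoutI.NormalWord.equivPair i p.1).head) * p.2)
      map_one' := by
        funext p
        refine Prod.ext ?_ ?_
        · simp; rfl
        · simp only [hcc1, map_one, one_mul]; rfl
      map_mul' := fun a a' => by
        funext p
        refine Prod.ext ?_ ?_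
        · change ψ i (a * a') • p.1 = ψ i a • ψ i a' • p.1
          rw [map_mul, mul_smul]
        · change _ = κ i (PushoutI.NormalWord.equivPair i (ψ i a' • p.1)).tail
            (cc i a (PushoutI.NormalWord.equivPair i (ψ i a' • p.1)).head) * (κ i _ _ * p.2)
          rw [hpair]
          simp only [hccm, map_mul, mul_assoc] }
  let actb : H →* Function.End (Ω × D) :=
    { toFun := fun h p => (h • p.1, p.2)
      map_one' := by
        funext p
        exact Prod.ext (one_smul _ _) rfl
      map_mul' := fun a a' => by
        funext p
        exact Prod.ext (mul_smul _ _ _) rfl }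
  let ρ : PushoutI φ →* Function.End (Ω × D) := PushoutI.lift act actb (by
    intro i
    refine MonoidHom.ext fun h => ?_
    funext p
    refine Prod.ext ?_ ?_
    · change ψ i (φ i h) • p.1 = h • p.1
      rw [← PushoutI.NormalWord.of_smul_eq_smul, ← PushoutI.NormalWord.base_smul_eq_smul]
      congr 1
      exact PushoutI.of_apply_eq_base (fun i => (ψ i).comp (φ i)) i h
    · change κ i _ (cc i (φ i h) _) * p.2 = p.2
      rw [hccφ, map_one, one_mul])
  have hρ : ∀ i a w d', ρ (PushoutI.of i a) (w, d') =
      (ψ i a • w, κ i (PushoutI.NormalWord.equivPair i w).tail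
        (cc i a (PushoutI.NormalWord.equivPair i w).head) * d') := by
    intro i a w d'
    simp only [ρ, PushoutI.lift_of]; rfl
  have hρb : ∀ h w d', ρ (PushoutI.base φ h) (w, d') = (h • w, d') := by
    intro i a w
    simp only [ρ, PushoutI.lift_base]; rfl
  let _ : MulAction (PushoutI φ) Ω := MulAction.compHom Ω π
  have hsm : ∀ (e : PushoutI φ) (w : Ω), e • w = π e • w := fun _ _ => rfl
  let f : (Σ i, B i) → PushoutI φ := fun p => PushoutI.of p.1 (σ p.1 p.2)
  have hf1 : ∀ i, f ⟨i, 1⟩ = 1 := fun i => by simp [f, hσ1]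
  let τ : CoprodI.Word B → PushoutI φ := fun w => (w.toList.map f).prod
  have hτ : ∀ i (p : CoprodI.Word.Pair B i),
      τ (CoprodI.Word.rcons p) = f ⟨i, p.head⟩ * τ p.tail :=
    fun i p => CoprodI.Word.prod_map_rcons f hf1 p
  let T : Ω → PushoutI φ := fun w => PushoutI.base φ w.head * τ w.toWord
  have hTr : ∀ i (p : PushoutI.NormalWord.Pair d i),
      T ((PushoutI.NormalWord.equivPair i).symm p) = PushoutI.of i (σ i p.head) * τ p.tail := by
    intro i p
    change PushoutI.base φ ((MonoidHom.ofInjective (d.injective i)).symm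
      ((d.compl i).equiv p.head).1) * τ ((CoprodI.Word.equivPair i).symm _) = _
    rw [CoprodI.Word.equivPair_symm, hτ]
    have h0 := (d.compl i).equiv_fst_mul_equiv_snd p.head
    have h1 : ψ i (φ i ((MonoidHom.ofInjective (d.injective i)).symm
      ((d.compl i).equiv p.head).1)) = ((d.compl i).equiv p.head).1 :=
      MonoidHom.apply_ofInjective_symm (d.injective i) _
    rw [← PushoutI.of_apply_eq_base φ i, ← mul_assoc]
    change PushoutI.of i _ * PushoutI.of i (σ i ((d.compl i).equiv p.head).2) * τ p.tail = _
    rw [← map_mul, ← hσφ, h1, h0]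
  have hTe : ∀ i (w : Ω), T w = PushoutI.of i (σ i (PushoutI.NormalWord.equivPair i w).head) *
      τ (PushoutI.NormalWord.equivPair i w).tail := by
    intro i w
    rw [← hTr, Equiv.symm_apply_apply]
  let b : D →* PushoutI φ := CoprodI.lift fun j =>
    (MulAut.conj (τ j.2)⁻¹).toMonoidHom.comp ((PushoutI.of j.1).comp (ψ j.1).ker.subtype)
  have hbκ : ∀ i t m, b (κ i t m) = (τ t)⁻¹ * PushoutI.of i (m : A i) * τ t := by
    intro i t m
    refine (CoprodI.lift_of (M := fun j : J => (ψ j.1).ker) (i := (i, t)) _ m).trans ?_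
    simp
  have hS : ∀ e : PushoutI φ, e ∈ Submonoid.closure
      ({e | ∃ i, ∃ a : A i, e = PushoutI.of i a} ∪ {e | ∃ h, e = PushoutI.base φ h}) := by
    intro e
    induction e using PushoutI.induction_on with
    | of i a => exact Submonoid.subset_closure (Or.inl ⟨i, a, rfl⟩)
    | base h => exact Submonoid.subset_closure (Or.inr ⟨h, rfl⟩)
    | mul x y hx hy => exact mul_mem hx hy
  let ω : Ω := PushoutI.NormalWord.empty
  obtain ⟨ν, hν, hνdef, hfst, hmul⟩ := exists_injective_hom_of_cocycle ρ T b _ hS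
    (by
      rintro _ (⟨i, a, rfl⟩ | ⟨h, rfl⟩) w d'
      · rw [hρ, hsm, hπ, PushoutI.NormalWord.of_smul_eq_smul]
      · rw [hρb, hsm, hπb, PushoutI.NormalWord.base_smul_eq_smul])
    (by
      rintro _ (⟨i, a, rfl⟩ | ⟨h, rfl⟩) w d' d''
      · rw [hρ, hρ, mul_assoc]
      · rw [hρb, hρb])
    (by
      rintro _ (⟨i, a, rfl⟩ | ⟨h, rfl⟩) w d'
      · rw [hρ, hTe i w, map_mul, hbκ, hTe i, hpair]
        simp only [cc, map_mul, map_inv]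
        group
      · rw [hρb]
        change PushoutI.base φ (h * w.head) * _ * _ = _ * (PushoutI.base φ w.head * _ * _)
        simp only [map_mul, mul_assoc]
        rfl)
    ω π.ker
    (by
      intro n hn w
      rw [hsm, (MonoidHom.mem_ker).1 hn, one_smul])
  refine ⟨J, Prod.fst, ν, hν, fun i m n hmn => ?_⟩
  obtain ⟨e, he⟩ := isConj_iff.1 hmn
  have hX : ∀ t m, CoprodI.lift (fun j : J => χ j.1) (κ i t m) = χ i m := fun t m =>
    CoprodI.lift_of (M := fun j : J => (ψ j.1).ker) (i := (i, t)) _ m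
  have hcomp : ∀ e f p, ρ (e * f) p = ρ e (ρ f p) := by
    intro e f p; rw [map_mul]; rfl
  obtain ⟨w, d', hwd⟩ : ∃ w d', ρ e⁻¹ (ω, 1) = (w, d') := ⟨_, _, rfl⟩
  have hwd' : ρ e (w, d') = (ω, 1) := by
    rw [← hwd, ← hcomp, mul_inv_cancel, map_one]; rfl
  have hm1 : ψ i m = 1 := m.2
  rw [hνdef, ← he, hcomp, hwd, hcomp, hρ, hm1, one_smul]
  have hk : ∀ k : D, k * d' = d' * (d'⁻¹ * k * d') := fun k => by
    rw [mul_assoc, mul_inv_cancel_left]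
  rw [hk, hmul, hwd', one_mul]
  simp only [map_mul, map_inv]
  rw [hX, mul_comm, mul_inv_cancel_left]
  refine hχ i (σ i (PushoutI.NormalWord.equivPair i w).head) m _ ?_
  simp [cc, hm1]

theorem IsFreeGroup.of_injective {A B : Type*} [Group A] [Group B] [IsFreeGroup B] (f : A →* B)
    (hf : Function.Injective f) : IsFreeGroup A :=
  IsFreeGroup.ofMulEquiv (MonoidHom.ofInjective hf).symm

theorem isFreeGroup_ker_comp {A B C : Type*} [Group A] [Group B] [Group C] (f : A →* B)
    (hf : Function.Injective f) (g : B →* C) (h : IsFreeGroup g.ker) :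
    IsFreeGroup (g.comp f).ker :=
  IsFreeGroup.of_injective ((f.comp (g.comp f).ker.subtype).codRestrict g.ker fun x => x.2)
    fun _ _ hxy => Subtype.ext (hf (congrArg Subtype.val hxy))

/-- The normal closure of `c` has an abelian quotient in which all conjugates of `c` become the
same element of order `m`, with free kernel. -/
def SplitsNormalClosure {G : Type} [Group G] (c : G) (m : ℕ) : Prop :=
  ∃ (C : Type) (_ : CommGroup C) (z : C) (φ : Subgroup.normalClosure ({c} : Set G) →* C),
    orderOf z = m ∧ (∀ x : Subgroup.normalClosure ({c} : Set G), IsConj c (x : G) → φ x = z) ∧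
      IsFreeGroup φ.ker

theorem Subgroup.normalClosure_singleton_induction {G : Type*} [Group G] {c : G}
    {p : Subgroup.normalClosure ({c} : Set G) → Prop}
    (hconj : ∀ x : Subgroup.normalClosure ({c} : Set G), IsConj c (x : G) → p x)
    (hone : p 1) (hmul : ∀ x y, p x → p y → p (x * y)) (hinv : ∀ x, p x → p x⁻¹)
    (x : Subgroup.normalClosure ({c} : Set G)) : p x := by
  obtain ⟨x, hx⟩ := x
  unfold Subgroup.normalClosure at hx
  induction hx using Subgroup.closure_induction with
  | mem y hy =>
    obtain ⟨c', hc', h⟩ := Group.mem_conjugatesOfSet_iff.1 hy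
    rw [Set.mem_singleton_iff.1 hc'] at h
    exact hconj _ h
  | one => exact hone
  | mul y z hy hz ihy ihz => exact hmul ⟨y, hy⟩ ⟨z, hz⟩ ihy ihz
  | inv y hy ih => exact hinv ⟨y, hy⟩ ih

theorem hom_normalClosure_conj {G C : Type*} [Group G] [CommGroup C] {c : G} {z : C}
    (φ : Subgroup.normalClosure ({c} : Set G) →* C)
    (hφ : ∀ x : Subgroup.normalClosure ({c} : Set G), IsConj c (x : G) → φ x = z)
    (x y : Subgroup.normalClosure ({c} : Set G)) (g : G) (h : (y : G) = g⁻¹ * x * g) :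
    φ y = φ x := by
  have key : ∀ x : Subgroup.normalClosure ({c} : Set G),
      φ (MulAut.conjNormal g⁻¹ x) = φ x := by
    intro x
    induction x using Subgroup.normalClosure_singleton_induction with
    | hconj x hx =>
      rw [hφ x hx]
      refine hφ _ (hx.trans (isConj_iff.2 ⟨g⁻¹, ?_⟩))
      rw [MulAut.conjNormal_apply]
    | hone => rw [map_one]
    | hmul x y hx hy => rw [map_mul, map_mul, map_mul, hx, hy]
    | hinv x hx => rw [map_inv (MulAut.conjNormal g⁻¹) x, map_inv φ, map_inv φ, hx]
  rw [← key x]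
  congr 1
  apply Subtype.ext
  rw [h, MulAut.conjNormal_apply]
  simp

theorem SplitsNormalClosure.of_injective {G G' : Type} [Group G] [Group G'] {c : G} {m : ℕ}
    (f : G →* G') (hf : Function.Injective f) (h : SplitsNormalClosure (f c) m) :
    SplitsNormalClosure c m := by
  obtain ⟨C, _, z, φ, hz, hφ, hfree⟩ := h
  have hle : ∀ x ∈ Subgroup.normalClosure ({c} : Set G),
      f x ∈ Subgroup.normalClosure ({f c} : Set G') := by
    intro x hx
    have : Subgroup.normalClosure ({c} : Set G) ≤
        (Subgroup.normalClosure ({f c} : Set G')).comap f :=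
      Subgroup.normalClosure_le_normal (by
        simpa using Subgroup.subset_normalClosure (Set.mem_singleton _))
    exact this hx
  let f' : Subgroup.normalClosure ({c} : Set G) →* Subgroup.normalClosure ({f c} : Set G') :=
    (f.comp (Subgroup.subtype _)).codRestrict _ fun x => hle x x.2
  refine ⟨C, _, z, φ.comp f', hz, fun x hx => hφ _ (f.map_isConj hx), ?_⟩
  exact isFreeGroup_ker_comp f' (fun x y hxy => Subtype.ext (hf (congrArg Subtype.val hxy))) φ hfree

theorem SplitsNormalClosure.exists_complement {G : Type} [Group G] {c : G} {m : ℕ}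
    (h : SplitsNormalClosure c m) (hc : c ^ m = 1) :
    orderOf c = m ∧ ∃ K : Subgroup (Subgroup.normalClosure ({c} : Set G)),
      K.Normal ∧ IsFreeGroup K ∧
      K ⊓ Subgroup.zpowers (⟨c, Subgroup.subset_normalClosure (Set.mem_singleton _)⟩ :
        Subgroup.normalClosure ({c} : Set G)) = ⊥ ∧
      K ⊔ Subgroup.zpowers (⟨c, Subgroup.subset_normalClosure (Set.mem_singleton _)⟩ :
        Subgroup.normalClosure ({c} : Set G)) = ⊤ := by
  obtain ⟨C, _, z, φ, hz, hφ, hfree⟩ := h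
  set c' : Subgroup.normalClosure ({c} : Set G) :=
    ⟨c, Subgroup.subset_normalClosure (Set.mem_singleton _)⟩ with hc'
  have hφc : φ c' = z := hφ _ (IsConj.refl c)
  have hcm : c' ^ m = 1 := Subtype.ext hc
  refine ⟨Nat.dvd_antisymm (orderOf_dvd_of_pow_eq_one hc) ?_, φ.ker, inferInstance, hfree, ?_, ?_⟩
  · rw [← hz, ← hφc, ← Subgroup.orderOf_mk c (Subgroup.subset_normalClosure (Set.mem_singleton c))]
    exact orderOf_map_dvd φ c'
  · rw [eq_bot_iff]
    rintro x ⟨hx, n, rfl⟩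
    have h1 : z ^ n = 1 := by
      rw [← hφc, ← map_zpow]; exact hx
    rw [Subgroup.mem_bot]
    obtain ⟨k, rfl⟩ : (m : ℤ) ∣ n := by rw [← hz]; exact orderOf_dvd_iff_zpow_eq_one.2 h1
    change c' ^ ((m : ℤ) * k) = 1
    rw [zpow_mul, zpow_natCast, hcm, one_zpow]
  · rw [eq_top_iff]
    intro x _
    have h1 : φ x ∈ Subgroup.zpowers z := by
      induction x using Subgroup.normalClosure_singleton_induction with
      | hconj x hx => rw [hφ x hx]; exact Subgroup.mem_zpowers z
      | hone => rw [map_one]; exact one_mem _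
      | hmul x y hx hy =>
        rw [map_mul]; exact mul_mem (hx trivial) (hy trivial)
      | hinv x hx => rw [map_inv]; exact inv_mem (hx trivial)
    obtain ⟨n, hn⟩ := h1
    have h2 : x * c' ^ (-n) ∈ φ.ker := by
      rw [MonoidHom.mem_ker, map_mul, map_zpow, hφc, zpow_neg, ← hn]
      exact mul_inv_cancel _
    have h3 : x = x * c' ^ (-n) * c' ^ n := by
      rw [mul_assoc, ← zpow_add]; simp
    rw [h3]
    exact Subgroup.mul_mem_sup h2 ⟨n, rfl⟩

/-- The two-element family with members `P` and `Q`. -/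
def AmalgamFamily (P Q : Type) : Bool → Type
  | true => P
  | false => Q

instance {P Q : Type} [Group P] [Group Q] : ∀ b, Group (AmalgamFamily P Q b)
  | true => inferInstanceAs (Group P)
  | false => inferInstanceAs (Group Q)

/-- A pair of homomorphisms, as a family indexed by `Bool`. -/
def amalgamMaps {S P Q : Type} [Group S] [Group P] [Group Q] (α : S →* P) (β : S →* Q) :
    ∀ b, S →* AmalgamFamily P Q b
  | true => α
  | false => β

/-- The pushout of two homomorphisms of groups. -/
abbrev Amalgam {S P Q : Type} [Group S] [Group P] [Group Q] (α : S →* P) (β : S →* Q) : Type :=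
  PushoutI (amalgamMaps α β)

namespace Amalgam

variable {S P Q : Type} [Group S] [Group P] [Group Q] (α : S →* P) (β : S →* Q)

/-- The map from the left factor. -/
def inl : P →* Amalgam α β := PushoutI.of (φ := amalgamMaps α β) true

/-- The map from the right factor. -/
def inr : Q →* Amalgam α β := PushoutI.of (φ := amalgamMaps α β) false

theorem inl_apply_eq (s : S) : inl α β (α s) = inr α β (β s) :=
  (PushoutI.of_apply_eq_base (amalgamMaps α β) true s).trans
    (PushoutI.of_apply_eq_base (amalgamMaps α β) false s).symm

theorem exists_lift {K : Type} [Group K] (f : P →* K) (g : Q →* K)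
    (h : ∀ s, f (α s) = g (β s)) :
    ∃ F : Amalgam α β →* K, (∀ p, F (inl α β p) = f p) ∧ ∀ q, F (inr α β q) = g q := by
  let k : ∀ b, AmalgamFamily P Q b →* K
    | true => f
    | false => g
  have hk : ∀ b, (k b).comp (amalgamMaps α β b) = f.comp α
    | true => rfl
    | false => MonoidHom.ext fun s => (h s).symm
  exact ⟨PushoutI.lift k (f.comp α) hk, fun p => PushoutI.lift_of k (f.comp α) hk (i := true) p,
    fun q => PushoutI.lift_of k (f.comp α) hk (i := false) q⟩

variable {α β}

theorem inl_injective (hα : Function.Injective α) (hβ : Function.Injective β) :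
    Function.Injective (inl α β) :=
  PushoutI.of_injective (φ := amalgamMaps α β) (fun | true => hα | false => hβ) true

theorem mem_normalClosure_of_inl_mem {c p : P}
    (hα : Function.Injective ((QuotientGroup.mk' (Subgroup.normalClosure {c})).comp α))
    (hβ : Function.Injective β)
    (h : inl α β p ∈ Subgroup.normalClosure {inl α β c}) : p ∈ Subgroup.normalClosure {c} := by
  let N := Subgroup.normalClosure {c}
  obtain ⟨F, hF, -⟩ := exists_lift α β
    ((inl ((QuotientGroup.mk' N).comp α) β).comp (QuotientGroup.mk' N))
    (inr ((QuotientGroup.mk' N).comp α) β)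
    fun s => inl_apply_eq ((QuotientGroup.mk' N).comp α) β s
  have hle : Subgroup.normalClosure {inl α β c} ≤ F.ker :=
    Subgroup.normalClosure_le_normal (by
      rw [Set.singleton_subset_iff, SetLike.mem_coe, MonoidHom.mem_ker, hF, MonoidHom.comp_apply,
        QuotientGroup.mk'_apply, (QuotientGroup.eq_one_iff c).2, map_one]
      exact Subgroup.subset_normalClosure (Set.mem_singleton _))
  have h1 := (MonoidHom.mem_ker).1 (hle h)
  rw [hF, MonoidHom.comp_apply, ← map_one (inl ((QuotientGroup.mk' N).comp α) β)] at h1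
  exact (QuotientGroup.eq_one_iff p).1 (inl_injective hα hβ h1)

end Amalgam

theorem SplitsNormalClosure.inl {S P Q : Type} [Group S] [Group P] [Group Q] {α : S →* P}
    {β : S →* Q} {c : P} {m : ℕ} (h : SplitsNormalClosure c m)
    (hα : Function.Injective ((QuotientGroup.mk' (Subgroup.normalClosure {c})).comp α))
    (hβ : Function.Injective β) : SplitsNormalClosure (Amalgam.inl α β c) m := by
  obtain ⟨C, _, z, φ, hz, hφ, hfree⟩ := h
  let N := Subgroup.normalClosure {c}
  let ψ : ∀ b, AmalgamFamily P Q b →* AmalgamFamily (P ⧸ N) Q b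
    | true => QuotientGroup.mk' N
    | false => MonoidHom.id Q
  have hψ : ∀ b, Function.Surjective (ψ b)
    | true => QuotientGroup.mk'_surjective N
    | false => Function.surjective_id
  have hinj : ∀ b, Function.Injective ((ψ b).comp (amalgamMaps α β b))
    | true => hα
    | false => hβ
  have hker : (QuotientGroup.mk' N).ker ≤ N := (QuotientGroup.ker_mk' N).le
  let χ : ∀ b, (ψ b).ker →* C
    | true => φ.comp (Subgroup.inclusion hker)
    | false => 1
  have hχ : ∀ b (a : AmalgamFamily P Q b) (x y : (ψ b).ker),
      (y : AmalgamFamily P Q b) = a⁻¹ * x * a → χ b y = χ b x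
    | true => fun a x y hxy => hom_normalClosure_conj φ hφ (Subgroup.inclusion hker x)
        (Subgroup.inclusion hker y) a hxy
    | false => fun _ _ _ _ => rfl
  have hχfree : ∀ b, IsFreeGroup (χ b).ker
    | true => isFreeGroup_ker_comp (Subgroup.inclusion hker)
        (Subgroup.inclusion_injective hker) φ hfree
    | false => by
      have : Subsingleton (ψ false).ker := by
        change Subsingleton (MonoidHom.id Q).ker
        rw [MonoidHom.ker_id]
        infer_instance
      exact IsFreeGroup.of_injective (1 : _ →* FreeGroup Empty)
        (Function.injective_of_subsingleton _)
  have hcompat : ∀ b, ((PushoutI.of (φ := fun b => (ψ b).comp (amalgamMaps α β b)) b).comp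
      (ψ b)).comp (amalgamMaps α β b) = PushoutI.base _ := fun b =>
    MonoidHom.ext fun s => PushoutI.of_apply_eq_base (fun b => (ψ b).comp (amalgamMaps α β b)) b s
  let π : Amalgam α β →* PushoutI fun b => (ψ b).comp (amalgamMaps α β b) :=
    PushoutI.lift (fun b => (PushoutI.of b).comp (ψ b)) (PushoutI.base _) hcompat
  have hπ : ∀ b (a : AmalgamFamily P Q b), π (PushoutI.of b a) = PushoutI.of b (ψ b a) :=
    fun b a => PushoutI.lift_of (fun b => (PushoutI.of b).comp (ψ b)) (PushoutI.base _) hcompat a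
  obtain ⟨J, idx, ν, hν, hνχ⟩ := exists_injective_hom_ker_pushout (amalgamMaps α β) ψ hψ hinj χ hχ π
    hπ (fun h => PushoutI.lift_base (fun b => (PushoutI.of b).comp (ψ b)) (PushoutI.base _) hcompat h)
  have hcN : c ∈ (QuotientGroup.mk' N).ker := by
    rw [QuotientGroup.ker_mk']
    exact Subgroup.subset_normalClosure (Set.mem_singleton _)
  have hle : Subgroup.normalClosure {Amalgam.inl α β c} ≤ π.ker := by
    refine Subgroup.normalClosure_le_normal ?_
    rw [Set.singleton_subset_iff, SetLike.mem_coe, MonoidHom.mem_ker]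
    refine (hπ true c).trans ?_
    exact (congrArg (PushoutI.of (φ := fun b => (ψ b).comp (amalgamMaps α β b)) true) hcN).trans
      (map_one _)
  refine ⟨C, _, z, (CoprodI.lift fun j => χ (idx j)).comp (ν.comp (Subgroup.inclusion hle)), hz,
    fun x hx => ?_, ?_⟩
  · refine (hνχ true ⟨c, hcN⟩ (Subgroup.inclusion hle x) hx).trans ?_
    exact hφ _ (IsConj.refl c)
  · exact isFreeGroup_ker_comp (ν.comp (Subgroup.inclusion hle))
      (hν.comp (Subgroup.inclusion_injective hle)) _
      (isFreeGroup_ker_lift _ fun j => hχfree (idx j))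

theorem CoprodI.injective_of_apply_of {ι : Type*} {M N : ι → Type*} [∀ i, Group (M i)]
    [∀ i, Group (N i)] (f : ∀ i, M i →* N i) (hf : ∀ i, Function.Injective (f i))
    (F : CoprodI M →* CoprodI N) (hF : ∀ i m, F (CoprodI.of (i := i) m) = CoprodI.of (f i m)) :
    Function.Injective F := by
  classical
  rw [injective_iff_map_eq_one]
  intro x hx
  obtain ⟨w, rfl⟩ : ∃ w : CoprodI.Word M, w.prod = x :=
    ⟨CoprodI.Word.equiv x, CoprodI.Word.equiv.symm_apply_apply x⟩
  let w' : CoprodI.Word N :=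
    { toList := w.toList.map fun p => ⟨p.1, f p.1 p.2⟩
      ne_one := by
        intro l hl
        obtain ⟨p, hp, rfl⟩ := List.mem_map.1 hl
        exact fun h => w.ne_one p hp (hf p.1 (h.trans (map_one _).symm))
      chain_ne := by
        rw [List.isChain_map]
        exact w.chain_ne }
  have hw' : F w.prod = w'.prod := by
    change F (List.prod _) = List.prod _
    rw [map_list_prod, List.map_map, List.map_map]
    congr 1
    refine List.map_congr_left fun p _ => ?_
    exact hF p.1 p.2
  have h1 : w'.prod = CoprodI.Word.empty.prod := by
    rw [← hw', hx, CoprodI.Word.prod_empty]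
  have h2 : w' = CoprodI.Word.empty := CoprodI.Word.equiv.symm.injective h1
  have h3 : w.toList = [] := by
    have : w'.toList = [] := by rw [h2]; rfl
    exact List.map_eq_nil_iff.1 this
  change List.prod _ = _
  rw [h3]
  rfl

theorem FreeGroup.injective_of_conj_pair {B C K : Type} [Group C] [Group K]
    (f₀ f₁ : FreeGroup B →* C) (h₀ : Function.Injective f₀) (h₁ : Function.Injective f₁)
    (F : FreeGroup (B ⊕ B) →* K)
    (hL : ∀ (L : Type) [Group L] (g : C →* L) (u : L), ∃ h : K →* L,
      (∀ b, h (F (FreeGroup.of (Sum.inl b))) = g (f₀ (FreeGroup.of b))) ∧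
      ∀ b, h (F (FreeGroup.of (Sum.inr b))) = u * g (f₁ (FreeGroup.of b)) * u⁻¹) :
    Function.Injective F := by
  let N := CoprodI fun _ : Bool => C
  let sw : N →* N := CoprodI.lift fun b => CoprodI.of (M := fun _ : Bool => C) (i := !b)
  have hsw : ∀ (b : Bool) (c : C), sw (CoprodI.of (M := fun _ : Bool => C) (i := b) c) =
      CoprodI.of (M := fun _ : Bool => C) (i := !b) c := fun b c =>
    CoprodI.lift_of (M := fun _ : Bool => C) _ c
  have hsw2 : sw.comp sw = MonoidHom.id N := CoprodI.ext_hom _ _ fun b => MonoidHom.ext fun c => by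
    simp only [MonoidHom.comp_apply, hsw, Bool.not_not]
    rfl
  let u : MulAut N := MonoidHom.toMulEquiv sw sw hsw2 hsw2
  let L := N ⋊[MonoidHom.id (MulAut N)] MulAut N
  obtain ⟨h, hl, hr⟩ := hL L (SemidirectProduct.inl.comp (CoprodI.of (M := fun _ : Bool => C)
    (i := true))) (SemidirectProduct.inr u)
  let ff : ∀ b : Bool, FreeGroup B →* C
    | true => f₀
    | false => f₁
  have hff : ∀ b, Function.Injective (ff b)
    | true => h₀
    | false => h₁
  let Ψ : CoprodI (fun _ : Bool => FreeGroup B) →* N := CoprodI.lift fun b =>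
    (CoprodI.of (M := fun _ : Bool => C) (i := b)).comp (ff b)
  have hΨ : ∀ b x, Ψ (CoprodI.of (M := fun _ : Bool => FreeGroup B) (i := b) x) =
      CoprodI.of (M := fun _ : Bool => C) (i := b) (ff b x) := fun b x =>
    CoprodI.lift_of (M := fun _ : Bool => FreeGroup B) _ x
  have hΨinj : Function.Injective Ψ := CoprodI.injective_of_apply_of ff hff Ψ hΨ
  let Θ : FreeGroup (B ⊕ B) →* CoprodI (fun _ : Bool => FreeGroup B) := FreeGroup.lift
    (Sum.elim (fun b => CoprodI.of (M := fun _ : Bool => FreeGroup B) (i := true) (FreeGroup.of b))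
      fun b => CoprodI.of (M := fun _ : Bool => FreeGroup B) (i := false) (FreeGroup.of b))
  let Θ' : CoprodI (fun _ : Bool => FreeGroup B) →* FreeGroup (B ⊕ B) := CoprodI.lift fun b =>
    FreeGroup.map fun x => if b then Sum.inl x else Sum.inr x
  have hΘ' : ∀ b x, Θ' (CoprodI.of (M := fun _ : Bool => FreeGroup B) (i := b) x) =
      FreeGroup.map (fun x => if b then Sum.inl x else Sum.inr x) x := fun b x =>
    CoprodI.lift_of (M := fun _ : Bool => FreeGroup B) _ x
  have hΘ : Function.LeftInverse Θ' Θ := by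
    intro x
    have : Θ'.comp Θ = MonoidHom.id _ := FreeGroup.ext_hom _ _ fun a => by
      rcases a with a | a
      · simp only [MonoidHom.comp_apply, Θ, FreeGroup.lift_apply_of, Sum.elim_inl, hΘ']
        simp
      · simp only [MonoidHom.comp_apply, Θ, FreeGroup.lift_apply_of, Sum.elim_inr, hΘ']
        simp
    exact DFunLike.congr_fun this x
  have hcomp : h.comp F = (SemidirectProduct.inl : N →* L).comp (Ψ.comp Θ) := by
    refine FreeGroup.ext_hom _ _ fun a => ?_
    rcases a with a | a
    · simp only [MonoidHom.comp_apply, Θ, FreeGroup.lift_apply_of, Sum.elim_inl, hΨ, hl]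
      rfl
    · simp only [MonoidHom.comp_apply, Θ, FreeGroup.lift_apply_of, Sum.elim_inr, hΨ, hr]
      have := SemidirectProduct.inl_aut (φ := MonoidHom.id (MulAut N)) u
        (CoprodI.of (M := fun _ : Bool => C) (i := true) (f₁ (FreeGroup.of a)))
      rw [_root_.map_inv] at this
      rw [← this]
      congr 1
  have : Function.Injective (h.comp F) := by
    rw [hcomp]
    exact SemidirectProduct.inl_injective.comp (hΨinj.comp hΘ.injective)
  exact Function.Injective.of_comp this

namespace FreeGroup

variable {X : Type}

/-- The subgroup generated by a set of basis elements. -/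
def spanOf (A : Set X) : Subgroup (FreeGroup X) := Subgroup.closure (FreeGroup.of '' A)

theorem of_mem_spanOf {A : Set X} {x : X} (hx : x ∈ A) : of x ∈ spanOf A :=
  Subgroup.subset_closure ⟨x, hx, rfl⟩

theorem spanOf_mono {A B : Set X} (h : A ⊆ B) : spanOf A ≤ spanOf B :=
  Subgroup.closure_mono (Set.image_mono h)

theorem map_mem_of_mem_spanOf {A : Set X} {K : Type*} [Group K] (f : FreeGroup X →* K)
    (H : Subgroup K) (h : ∀ x ∈ A, f (of x) ∈ H) {w : FreeGroup X} (hw : w ∈ spanOf A) :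
    f w ∈ H := by
  have : spanOf A ≤ H.comap f := by
    refine (Subgroup.closure_le _).2 ?_
    rintro _ ⟨x, hx, rfl⟩
    exact h x hx
  exact this hw

theorem hom_eq_of_mem_spanOf {A : Set X} {K : Type*} [Group K] (f g : FreeGroup X →* K)
    (h : ∀ x ∈ A, f (of x) = g (of x)) {w : FreeGroup X} (hw : w ∈ spanOf A) : f w = g w := by
  have := MonoidHom.eqOn_closure (f := f) (g := g) (s := FreeGroup.of '' A) (by
    rintro _ ⟨x, hx, rfl⟩
    exact h x hx)
  exact this hw

theorem map_mem_spanOf {Y : Type} (f : X → Y) {B : Set Y} (h : ∀ x, f x ∈ B) (w : FreeGroup X) :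
    map f w ∈ spanOf B := by
  induction w using FreeGroup.induction_on with
  | C1 => rw [_root_.map_one]; exact one_mem _
  | of x => rw [map.of]; exact of_mem_spanOf (h x)
  | inv_of x hx => rw [_root_.map_inv]; exact inv_mem hx
  | mul x y hx hy => rw [_root_.map_mul]; exact mul_mem hx hy

open Classical in
/-- The retraction onto the subgroup generated by `A` which kills all other basis elements. -/
noncomputable def keep (A : Set X) : FreeGroup X →* FreeGroup X :=
  lift fun x => if x ∈ A then of x else 1

theorem keep_eq_self {A : Set X} {w : FreeGroup X} (hw : w ∈ spanOf A) : keep A w = w :=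
  hom_eq_of_mem_spanOf (keep A) (MonoidHom.id _) (fun x hx => by simp [keep, hx]) hw

theorem keep_mem_inter {A B : Set X} {w : FreeGroup X} (hw : w ∈ spanOf B) :
    keep A w ∈ spanOf (A ∩ B) := by
  refine map_mem_of_mem_spanOf _ _ (fun x hx => ?_) hw
  by_cases hxA : x ∈ A
  · simpa [keep, hxA] using of_mem_spanOf (A := A ∩ B) ⟨hxA, hx⟩
  · simp [keep, hxA]

theorem mem_spanOf_univ (w : FreeGroup X) : w ∈ spanOf (Set.univ : Set X) := by
  have := map_mem_spanOf (B := Set.univ) (id : X → X) (fun _ => trivial) w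
  rwa [map.id] at this

theorem keep_mem (A : Set X) (w : FreeGroup X) : keep A w ∈ spanOf A := by
  have := keep_mem_inter (A := A) (mem_spanOf_univ w)
  rwa [Set.inter_univ] at this

open Classical in
theorem keep_mk (A : Set X) (L : List (X × Bool)) :
    keep A (mk L) = mk (L.filter fun p => p.1 ∈ A) := by
  induction L with
  | nil => rw [List.filter_nil, ← one_eq_mk, _root_.map_one]
  | cons p L ih =>
    have h1 : mk (p :: L) = mk [p] * mk L := by rw [mul_mk]; rfl
    have h2 : keep A (mk [p]) = if p.1 ∈ A then mk [p] else 1 := by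
      obtain ⟨x, b⟩ := p
      by_cases hx : x ∈ A <;> cases b <;> simp [keep, hx, of, inv_mk, invRev]
    rw [h1, _root_.map_mul, h2, ih, List.filter_cons]
    by_cases hp : p.1 ∈ A
    · simp [hp, mul_mk]
    · simp [hp]

theorem mk_mem_spanOf (A : Set X) (L : List (X × Bool)) (h : ∀ p ∈ L, p.1 ∈ A) :
    mk L ∈ spanOf A := by
  classical
  have h1 : keep A (mk L) = mk L := by
    rw [keep_mk]
    congr 1
    exact List.filter_eq_self.2 fun p hp => by simpa using h p hp
  rw [← h1]
  exact keep_mem A _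

theorem norm_keep_le [DecidableEq X] (A : Set X) (w : FreeGroup X) : norm (keep A w) ≤ norm w := by
  classical
  conv_lhs => rw [← mk_toWord (x := w), keep_mk]
  exact norm_mk_le.trans (List.length_filter_le _ _)

theorem mem_spanOf_of_norm_keep [DecidableEq X] {A : Set X} {w : FreeGroup X}
    (h : norm w ≤ norm (keep A w)) : w ∈ spanOf A := by
  classical
  have h1 : keep A w = w := by
    conv_lhs => rw [← mk_toWord (x := w), keep_mk]
    conv_rhs => rw [← mk_toWord (x := w)]
    congr 1
    refine List.filter_eq_self.2 (List.length_filter_eq_length_iff.1 (le_antisymm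
      (List.length_filter_le _ _) (le_trans h ?_)))
    conv_lhs => rw [← mk_toWord (x := w), keep_mk]
    exact norm_mk_le
  rw [← h1]
  exact keep_mem A w

/-- No conjugate of `q` avoids the basis element `x`. -/
def Involves (x : X) (q : FreeGroup X) : Prop :=
  ∀ q', IsConj q q' → q' ∉ spanOf {x}ᶜ

theorem Involves.of_isConj {x : X} {q q' : FreeGroup X} (h : Involves x q) (hq : IsConj q q') :
    Involves x q' := fun q'' h' => h q'' (hq.trans h')

theorem isConj_keep_of_not_involves {x : X} {q : FreeGroup X} (h : ¬ Involves x q) :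
    IsConj q (keep {x}ᶜ q) := by
  simp only [Involves, not_forall, not_not] at h
  obtain ⟨q', hq', h⟩ := h
  have := (keep {x}ᶜ).map_isConj hq'
  rw [keep_eq_self h] at this
  exact hq'.trans this.symm

theorem exists_isConj_forall_mem_or_involves [DecidableEq X] (q : FreeGroup X) :
    ∃ q', IsConj q q' ∧ norm q' ≤ norm q ∧ ∀ x, q' ∈ spanOf {x}ᶜ ∨ Involves x q' := by
  classical
  have hex : ∃ n, ∃ q', IsConj q q' ∧ norm q' = n := ⟨_, q, IsConj.refl q, rfl⟩
  obtain ⟨q', hq', hn⟩ := Nat.find_spec hex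
  refine ⟨q', hq', hn ▸ Nat.find_min' hex ⟨q, IsConj.refl q, rfl⟩, fun x => ?_⟩
  by_cases hx : Involves x q'
  · exact Or.inr hx
  · refine Or.inl (mem_spanOf_of_norm_keep ?_)
    rw [hn]
    exact Nat.find_min' hex ⟨_, hq'.trans (isConj_keep_of_not_involves hx), rfl⟩

/-- Indexed letters other than `t`, with the indices of `a` restricted to `[0, k)`. -/
def window (t a : X) (k : ℤ) : Set (X × ℤ) := {p | p.1 ≠ t ∧ (p.1 = a → 0 ≤ p.2 ∧ p.2 < k)}

open Classical in
/-- The homomorphism sending `(x, i)` to `t ^ i * x * t ^ (-i)`. -/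
noncomputable def unindex (t : X) : FreeGroup (X × ℤ) →* FreeGroup X :=
  lift fun p => if p.1 = t then 1 else of t ^ p.2 * of p.1 * (of t ^ p.2)⁻¹

theorem unindex_of {t : X} {p : X × ℤ} (h : p.1 ≠ t) :
    unindex t (of p) = of t ^ p.2 * of p.1 * (of t ^ p.2)⁻¹ := by
  simp [unindex, h]

theorem unindex_of_self (t : X) (i : ℤ) : unindex t (of (t, i)) = 1 := by
  simp [unindex]

theorem quotient_mk_comp_injective_of_conj_pair {Y B : Type} (A : Set Y) (u : Y) (huA : u ∉ A)
    (s₀ s₁ : B → Y) (h₀ : Function.Injective s₀) (h₁ : Function.Injective s₁)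
    (hs₀ : ∀ b, s₀ b ∈ A) (hs₁ : ∀ b, s₁ b ∈ A)
    (q : FreeGroup Y) (hq : q ∈ spanOf A)
    (hq₀ : ∀ w ∈ spanOf (Set.range s₀), w ∈ Subgroup.normalClosure {q} → w = 1)
    (hq₁ : ∀ w ∈ spanOf (Set.range s₁), w ∈ Subgroup.normalClosure {q} → w = 1)
    {K : Type} [Group K] (π : FreeGroup Y →* K) (hπ : Function.Surjective π)
    (hker : π.ker = Subgroup.normalClosure {q}) :
    Function.Injective (π.comp (lift (Sum.elim (fun b => of (s₀ b))
      fun b => of u * of (s₁ b) * (of u)⁻¹))) := by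
  classical
  have hinj : ∀ s : B → Y, Function.Injective s →
      (∀ w ∈ spanOf (Set.range s), w ∈ Subgroup.normalClosure {q} → w = 1) →
      Function.Injective (π.comp (map s)) := by
    intro s hs hw
    rw [injective_iff_map_eq_one]
    intro w h
    have h1 : map s w ∈ π.ker := h
    rw [hker] at h1
    have h2 := hw _ (map_mem_spanOf s (B := Set.range s) (fun b => Set.mem_range_self b) w) h1
    exact map_injective hs (h2.trans (_root_.map_one _).symm)
  refine injective_of_conj_pair (π.comp (map s₀)) (π.comp (map s₁)) (hinj s₀ h₀ hq₀)
    (hinj s₁ h₁ hq₁) _ fun L _ g v => ?_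
  let h0 : FreeGroup Y →* L := lift fun y => if y = u then v else g (π (of y))
  have hA : ∀ y ∈ A, h0 (of y) = g (π (of y)) := fun y hy => by
    have : y ≠ u := fun h => huA (h ▸ hy)
    simp [h0, this]
  have hu : h0 (of u) = v := by simp [h0]
  have hker0 : π.ker ≤ h0.ker := by
    rw [hker]
    refine Subgroup.normalClosure_le_normal ?_
    rw [Set.singleton_subset_iff, SetLike.mem_coe, MonoidHom.mem_ker,
      hom_eq_of_mem_spanOf h0 (g.comp π) hA hq]
    have : q ∈ π.ker := by rw [hker]; exact Subgroup.subset_normalClosure (Set.mem_singleton _)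
    rw [MonoidHom.comp_apply, (MonoidHom.mem_ker).1 this, _root_.map_one]
  refine ⟨π.liftOfSurjective hπ ⟨h0, hker0⟩, fun b => ?_, fun b => ?_⟩
  · have := MonoidHom.liftOfRightInverse_comp_apply π _ (Function.rightInverse_surjInv hπ)
      ⟨h0, hker0⟩ (of (s₀ b))
    simp only [MonoidHom.comp_apply, lift_apply_of, Sum.elim_inl, map.of]
    exact this.trans (hA _ (hs₀ b))
  · have := MonoidHom.liftOfRightInverse_comp_apply π _ (Function.rightInverse_surjInv hπ)
      ⟨h0, hker0⟩ (of u * of (s₁ b) * (of u)⁻¹)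
    simp only [MonoidHom.comp_apply, lift_apply_of, Sum.elim_inr, map.of]
    refine this.trans ?_
    rw [_root_.map_mul, _root_.map_mul, _root_.map_inv, hA _ (hs₁ b)]
    change h0 (of u) * _ * (h0 (of u))⁻¹ = _
    rw [hu]

theorem exists_amalgam_embedding {t a : X} (hta : a ≠ t) {k : ℤ}
    {q : FreeGroup (X × ℤ)} (hq : q ∈ spanOf (window t a k))
    (hq₀ : ∀ w ∈ spanOf {(a, k - 1)}ᶜ, w ∈ Subgroup.normalClosure {q} → w = 1)
    (hq₁ : ∀ w ∈ spanOf {(a, 0)}ᶜ, w ∈ Subgroup.normalClosure {q} → w = 1) (m : ℕ) :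
    ∃ (S : Type) (_ : Group S)
      (α : S →* FreeGroup (X × ℤ) ⧸ Subgroup.normalClosure {q ^ m})
      (β : S →* FreeGroup (X × ℤ)) (emb : FreeGroup X →* Amalgam α β),
      Function.Injective ((QuotientGroup.mk' (Subgroup.normalClosure
        {(QuotientGroup.mk q : FreeGroup (X × ℤ) ⧸ Subgroup.normalClosure {q ^ m})})).comp α) ∧
      Function.Injective β ∧
      (∀ v ∈ spanOf (window t a k), emb (unindex t v) = Amalgam.inl α β (QuotientGroup.mk v)) ∧
      emb.ker ≤ Subgroup.normalClosure {unindex t q ^ m} := by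
  classical
  let N := Subgroup.normalClosure {q ^ m}
  let R := Subgroup.normalClosure {unindex t q ^ m}
  let B := window t a (k - 1)
  let sh : B → X × ℤ := fun b => (b.1.1, b.1.2 + 1)
  have hshinj : Function.Injective sh := by
    rintro ⟨⟨x, i⟩, _⟩ ⟨⟨y, j⟩, _⟩ h
    simpa [sh] using h
  let αβ : FreeGroup (B ⊕ B) →* FreeGroup (X × ℤ) := lift (Sum.elim (fun b => of (b : X × ℤ))
    fun b => of (t, 0) * of (sh b) * (of (t, 0))⁻¹)
  let β : FreeGroup (B ⊕ B) →* FreeGroup (X × ℤ) := lift (Sum.elim (fun b => of (b : X × ℤ))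
    fun b => of (t, 0) * of (b : X × ℤ) * (of (t, 0))⁻¹)
  let α : FreeGroup (B ⊕ B) →* FreeGroup (X × ℤ) ⧸ N := (QuotientGroup.mk' N).comp αβ
  have hqA : q ∈ spanOf {p : X × ℤ | p.1 ≠ t} := spanOf_mono (fun p hp => hp.1) hq
  have hα : Function.Injective ((QuotientGroup.mk' (Subgroup.normalClosure
      {(QuotientGroup.mk q : FreeGroup (X × ℤ) ⧸ N)})).comp α) := by
    refine quotient_mk_comp_injective_of_conj_pair {p : X × ℤ | p.1 ≠ t} (t, 0) (by simp)
      (fun b : B => (b : X × ℤ)) sh Subtype.val_injective hshinj (fun b => b.2.1)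
      (fun b => b.2.1) q hqA ?_ ?_ ((QuotientGroup.mk' _).comp (QuotientGroup.mk' N))
      ((QuotientGroup.mk'_surjective _).comp (QuotientGroup.mk'_surjective N)) ?_
    · intro w hw
      refine hq₀ w (spanOf_mono ?_ hw)
      rintro _ ⟨⟨⟨x, i⟩, hb⟩, rfl⟩ h
      have h1 := Prod.ext_iff.1 (Set.mem_singleton_iff.1 h)
      have h2 := hb.2 h1.1
      simp only at h1 h2
      omega
    · intro w hw
      refine hq₁ w (spanOf_mono ?_ hw)
      rintro _ ⟨⟨⟨x, i⟩, hb⟩, rfl⟩ h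
      have h1 := Prod.ext_iff.1 (Set.mem_singleton_iff.1 h)
      have h2 := hb.2 h1.1
      simp only [sh] at h1 h2
      omega
    · have hNle : N ≤ Subgroup.normalClosure {q} := Subgroup.normalClosure_le_normal (by
        rw [Set.singleton_subset_iff]
        exact pow_mem (Subgroup.subset_normalClosure (Set.mem_singleton _)) m)
      rw [← MonoidHom.comap_ker, QuotientGroup.ker_mk']
      have h1 : Subgroup.normalClosure {(QuotientGroup.mk q : FreeGroup (X × ℤ) ⧸ N)} =
          (Subgroup.normalClosure {q}).map (QuotientGroup.mk' N) := by
        rw [Subgroup.map_normalClosure _ _ (QuotientGroup.mk'_surjective N), Set.image_singleton]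
        rfl
      rw [h1, Subgroup.comap_map_eq, QuotientGroup.ker_mk', sup_eq_left.2 hNle]
  have hβ : Function.Injective β :=
    quotient_mk_comp_injective_of_conj_pair {p : X × ℤ | p.1 ≠ t} (t, 0) (by simp)
      (fun b : B => (b : X × ℤ)) (fun b : B => (b : X × ℤ)) Subtype.val_injective
      Subtype.val_injective (fun b => b.2.1) (fun b => b.2.1) 1 (one_mem _)
      (fun w _ hw => Subgroup.mem_bot.1 (Subgroup.normalClosure_one.le hw))
      (fun w _ hw => Subgroup.mem_bot.1 (Subgroup.normalClosure_one.le hw)) (MonoidHom.id _)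
      Function.surjective_id (by rw [MonoidHom.ker_id, Subgroup.normalClosure_one])
  let il := Amalgam.inl α β
  let ir := Amalgam.inr α β
  let T : Amalgam α β := (il (QuotientGroup.mk (of (t, 0))))⁻¹ * ir (of (t, 0))
  let emb : FreeGroup X →* Amalgam α β := lift fun x =>
    if x = t then T else il (QuotientGroup.mk (of (x, 0)))
  have hembt : emb (of t) = T := by simp [emb]
  have hembx : ∀ x, x ≠ t → emb (of x) = il (QuotientGroup.mk (of (x, 0))) := fun x hx => by
    simp [emb, hx]
  have hT : ∀ x i, (x, i) ∈ B → T * il (QuotientGroup.mk (of (x, i))) * T⁻¹ =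
      il (QuotientGroup.mk (of (x, i + 1))) := by
    intro x i hxi
    have e1 : il (QuotientGroup.mk (of (x, i))) = ir (of (x, i)) := by
      have := Amalgam.inl_apply_eq α β (of (Sum.inl ⟨(x, i), hxi⟩))
      simpa [α, αβ, β] using this
    have e2 : il (QuotientGroup.mk (of (t, 0))) * il (QuotientGroup.mk (of (x, i + 1))) *
        (il (QuotientGroup.mk (of (t, 0))))⁻¹ = ir (of (t, 0)) * ir (of (x, i)) *
        (ir (of (t, 0)))⁻¹ := by
      have := Amalgam.inl_apply_eq α β (of (Sum.inr ⟨(x, i), hxi⟩))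
      simpa [α, αβ, β, sh] using this
    rw [e1]
    have e3 : T * ir (of (x, i)) * T⁻¹ = (il (QuotientGroup.mk (of (t, 0))))⁻¹ *
      (ir (of (t, 0)) * ir (of (x, i)) * (ir (of (t, 0)))⁻¹) * il (QuotientGroup.mk (of (t, 0))) := by
      simp only [T]; group
    rw [e3, ← e2]
    group
  have hTpow : ∀ x i, (x, i) ∈ window t a k → emb (unindex t (of (x, i))) =
      il (QuotientGroup.mk (of (x, i))) := by
    intro x i hxi
    rw [unindex_of hxi.1, _root_.map_mul, _root_.map_mul, _root_.map_inv, map_zpow, hembt,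
      hembx x hxi.1]
    have hup : ∀ i : ℤ, (x, i) ∈ B → T ^ i * il (QuotientGroup.mk (of (x, 0))) * (T ^ i)⁻¹ =
        il (QuotientGroup.mk (of (x, i))) → T ^ (i + 1) * il (QuotientGroup.mk (of (x, 0))) *
        (T ^ (i + 1))⁻¹ = il (QuotientGroup.mk (of (x, i + 1))) := by
      intro i hi h
      rw [← hT x i hi, ← h]
      group
    by_cases hxa : x = a
    · obtain ⟨h0, h1⟩ := hxi.2 hxa
      simp only at h0 h1
      induction i, h0 using Int.leInduction with
      | base => simp
      | succ n hn ih =>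
        refine hup n ⟨hxi.1, fun _ => ⟨hn, by simpa using (by omega : n < k - 1)⟩⟩
          (ih ⟨hxi.1, fun _ => ⟨hn, by simpa using (by omega : n < k)⟩⟩ (by omega))
    · have hB : ∀ j, (x, j) ∈ B := fun j => ⟨hxi.1, fun h => absurd h hxa⟩
      clear hxi
      induction i using Int.induction_on with
      | zero => simp
      | succ n ih => exact hup _ (hB _) ih
      | pred n ih =>
        have h1 := hT x (-(n : ℤ) - 1) (hB _)
        rw [sub_add_cancel, ← ih] at h1
        have h2 : il (QuotientGroup.mk (of (x, -(n : ℤ) - 1))) = T⁻¹ * (T *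
          il (QuotientGroup.mk (of (x, -(n : ℤ) - 1))) * T⁻¹) * T := by group
        rw [h2, h1]
        group
  have hembv : ∀ v ∈ spanOf (window t a k), emb (unindex t v) = il (QuotientGroup.mk v) :=
    fun v hv => hom_eq_of_mem_spanOf (emb.comp (unindex t)) (il.comp (QuotientGroup.mk' N))
      (fun p hp => hTpow p.1 p.2 hp) hv
  refine ⟨_, _, α, β, emb, hα, hβ, hembv, ?_⟩
  have hNR : N ≤ ((QuotientGroup.mk' R).comp (unindex t)).ker :=
    Subgroup.normalClosure_le_normal (by
      rw [Set.singleton_subset_iff, SetLike.mem_coe, MonoidHom.mem_ker, MonoidHom.comp_apply,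
        _root_.map_pow]
      exact (QuotientGroup.eq_one_iff _).2 (Subgroup.subset_normalClosure (Set.mem_singleton _)))
  let g : FreeGroup (X × ℤ) →* FreeGroup X ⧸ R := (QuotientGroup.mk' R).comp
    (lift fun p => if p.1 = t then of t else unindex t (of p))
  have hgt : g (of (t, 0)) = QuotientGroup.mk (of t) := by simp [g]
  have hgx : ∀ p : X × ℤ, p.1 ≠ t → g (of p) = QuotientGroup.mk (unindex t (of p)) :=
    fun p hp => by simp [g, hp]
  obtain ⟨F, hF, hF'⟩ := Amalgam.exists_lift α β (QuotientGroup.lift N _ hNR) g (by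
    intro s
    have : ((QuotientGroup.lift N _ hNR).comp α) = g.comp β := by
      refine FreeGroup.ext_hom _ _ fun b => ?_
      have hl : ∀ w, QuotientGroup.lift N _ hNR (QuotientGroup.mk w) =
        (QuotientGroup.mk (unindex t w) : FreeGroup X ⧸ R) := fun w => rfl
      rcases b with ⟨⟨x, i⟩, hb⟩ | ⟨⟨x, i⟩, hb⟩
      · simp only [MonoidHom.comp_apply, α, αβ, β, lift_apply_of, Sum.elim_inl,
          QuotientGroup.mk'_apply, hl]
        rw [hgx _ hb.1]
      · simp only [MonoidHom.comp_apply, α, αβ, β, lift_apply_of, Sum.elim_inr,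
          QuotientGroup.mk'_apply, hl, _root_.map_mul, _root_.map_inv]
        rw [hgx _ hb.1, hgt, unindex_of_self, unindex_of hb.1, unindex_of (p := sh _) hb.1]
        simp only [sh, ← QuotientGroup.mk_mul, ← QuotientGroup.mk_inv]
        congr 1
        group
    exact DFunLike.congr_fun this s)
  have hFemb : F.comp emb = QuotientGroup.mk' R := by
    refine FreeGroup.ext_hom _ _ fun x => ?_
    by_cases hx : x = t
    · subst hx
      rw [MonoidHom.comp_apply, hembt]
      change F ((il _)⁻¹ * ir _) = _
      rw [_root_.map_mul, _root_.map_inv, hF, hF', hgt]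
      change (QuotientGroup.mk (unindex x (of (x, 0))))⁻¹ * _ = _
      rw [unindex_of_self]
      simp
    · rw [MonoidHom.comp_apply, hembx x hx, hF]
      change QuotientGroup.mk (unindex t (of (x, 0))) = _
      rw [unindex_of (p := (x, 0)) hx]
      simp
  change emb.ker ≤ R
  rw [← QuotientGroup.ker_mk' R, ← hFemb]
  intro x hx
  rw [MonoidHom.mem_ker, MonoidHom.comp_apply, (MonoidHom.mem_ker).1 hx, _root_.map_one]

end FreeGroup

theorem SplitsNormalClosure.of_isConj {G : Type} [Group G] {c d : G} {m : ℕ} (h : IsConj c d)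
    (hd : SplitsNormalClosure d m) : SplitsNormalClosure c m := by
  obtain ⟨b, rfl⟩ := isConj_iff.1 h
  exact .of_injective (MulAut.conj b).toMonoidHom (MulAut.conj b).injective hd

namespace FreeGroup

variable {X : Type}

/-- The group presented by a single relator. -/
abbrev OneRelator (r : FreeGroup X) : Type := FreeGroup X ⧸ Subgroup.normalClosure {r}

/-- The splitting holds for all one-relator groups with relator a power of `q`. -/
def SplitsPowers (q : FreeGroup X) : Prop :=
  ∀ m : ℕ, 0 < m → SplitsNormalClosure (QuotientGroup.mk q : OneRelator (q ^ m)) m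

/-- Words without the basis element `x` are nontrivial modulo `q`, unless they are trivial. -/
def FreeAway (x : X) (q : FreeGroup X) : Prop :=
  ∀ w ∈ spanOf {x}ᶜ, w ∈ Subgroup.normalClosure {q} → w = 1

theorem splitsNormalClosure_of_ker_eq {G A : Type} [Group G] [Group A] {π : FreeGroup X →* G}
    (hπ : Function.Surjective π) (f : FreeGroup X →* A) (hker : f.ker = π.ker) {q : FreeGroup X}
    {m : ℕ} (h : SplitsNormalClosure (f q) m) : SplitsNormalClosure (π q) m := by
  let g : G →* A := π.liftOfSurjective hπ ⟨f, hker.ge⟩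
  have hg : ∀ x, g (π x) = f x :=
    MonoidHom.liftOfRightInverse_comp_apply π _ (Function.rightInverse_surjInv hπ) ⟨f, hker.ge⟩
  refine .of_injective g ?_ (by rwa [hg])
  rw [injective_iff_map_eq_one]
  intro y hy
  obtain ⟨x, rfl⟩ := hπ y
  rw [hg] at hy
  have : x ∈ f.ker := hy
  rwa [hker] at this

theorem SplitsPowers.of_ker_eq {q : FreeGroup X}
    (h : ∀ m : ℕ, 0 < m → ∃ (A : Type) (_ : Group A) (f : FreeGroup X →* A),
      f.ker = Subgroup.normalClosure {q ^ m} ∧ SplitsNormalClosure (f q) m) :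
    SplitsPowers q := by
  intro m hm
  obtain ⟨A, _, f, hf, h⟩ := h m hm
  exact splitsNormalClosure_of_ker_eq (QuotientGroup.mk'_surjective _) f
    (by rw [hf, QuotientGroup.ker_mk']) h

theorem SplitsPowers.of_isConj {q q' : FreeGroup X} (h : SplitsPowers q') (hc : IsConj q q') :
    SplitsPowers q :=
  .of_ker_eq fun m hm => ⟨_, _, QuotientGroup.mk' (Subgroup.normalClosure {q' ^ m}), by
    rw [QuotientGroup.ker_mk', Subgroup.normalClosure_eq_of_isConj]
    obtain ⟨b, rfl⟩ := isConj_iff.1 hc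
    rw [conj_pow]
    exact isConj_comm.1 (isConj_iff.2 ⟨b, rfl⟩),
    (h m hm).of_isConj ((QuotientGroup.mk' _).map_isConj hc)⟩

theorem FreeAway.of_isConj {x : X} {q q' : FreeGroup X} (h : FreeAway x q') (hc : IsConj q q') :
    FreeAway x q := fun w hw hwq =>
  h w hw (Subgroup.normalClosure_eq_of_isConj hc ▸ hwq)

theorem SplitsPowers.unindex {t a : X} (hta : a ≠ t) {k : ℤ} {q : FreeGroup (X × ℤ)}
    (hq : q ∈ spanOf (window t a k)) (hq₀ : FreeAway (a, k - 1) q) (hq₁ : FreeAway (a, 0) q)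
    (h : SplitsPowers q) : SplitsPowers (unindex t q) := by
  refine .of_ker_eq fun m hm => ?_
  obtain ⟨S, _, α, β, emb, hα, hβ, hemb, hker⟩ := exists_amalgam_embedding hta hq hq₀ hq₁ m
  refine ⟨_, _, emb, le_antisymm hker (Subgroup.normalClosure_le_of_mem ?_), ?_⟩
  · rw [MonoidHom.mem_ker, ← _root_.map_pow, hemb _ (pow_mem hq m),
      (QuotientGroup.eq_one_iff _).2 (Subgroup.self_mem_normalClosure _), _root_.map_one]
  · rw [hemb q hq]
    exact (h m hm).inl hα hβ

theorem mem_normalClosure_of_unindex {t a : X} (hta : a ≠ t) {k : ℤ} {q : FreeGroup (X × ℤ)}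
    (hq : q ∈ spanOf (window t a k)) (hq₀ : FreeAway (a, k - 1) q) (hq₁ : FreeAway (a, 0) q)
    {v : FreeGroup (X × ℤ)} (hv : v ∈ spanOf (window t a k))
    (h : FreeGroup.unindex t v ∈ Subgroup.normalClosure {FreeGroup.unindex t q}) :
    v ∈ Subgroup.normalClosure {q} := by
  obtain ⟨S, _, α, β, emb, hα, hβ, hemb, hker⟩ := exists_amalgam_embedding hta hq hq₀ hq₁ 1
  have h1 : emb (FreeGroup.unindex t v) ∈ Subgroup.normalClosure {emb (FreeGroup.unindex t q)} := by
    have : Subgroup.normalClosure {FreeGroup.unindex t q} ≤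
        (Subgroup.normalClosure {emb (FreeGroup.unindex t q)}).comap emb :=
      Subgroup.normalClosure_le_of_mem (Subgroup.self_mem_normalClosure (emb _))
    exact this h
  rw [hemb v hv, hemb q hq] at h1
  have h2 := Amalgam.mem_normalClosure_of_inl_mem hα hβ h1
  rw [(QuotientGroup.eq_one_iff q).2 (by rw [pow_one]; exact Subgroup.self_mem_normalClosure q),
    Subgroup.normalClosure_one, Subgroup.mem_bot, QuotientGroup.eq_one_iff, pow_one] at h2
  exact h2

theorem forall_mem_toWord_of_mem_spanOf [DecidableEq X] {A : Set X} {w : FreeGroup X}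
    (h : w ∈ spanOf A) : ∀ p ∈ w.toWord, p.1 ∈ A := by
  classical
  have h1 : norm w ≤ (w.toWord.filter fun p => p.1 ∈ A).length := by
    conv_lhs => rw [← keep_eq_self h, ← mk_toWord (x := w), keep_mk]
    exact norm_mk_le
  have h2 := List.length_filter_eq_length_iff.1 (le_antisymm (List.length_filter_le _ _) h1)
  simpa using h2

theorem mem_spanOf_iff_forall_mem_toWord [DecidableEq X] {A : Set X} {w : FreeGroup X} :
    w ∈ spanOf A ↔ ∀ p ∈ w.toWord, p.1 ∈ A := by
  refine ⟨forall_mem_toWord_of_mem_spanOf, fun h => ?_⟩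
  rw [← mk_toWord (x := w)]
  exact mk_mem_spanOf A _ h

theorem mem_spanOf_of_forall_not_mem {A : Set X} {w : FreeGroup X}
    (h : ∀ x, x ∉ A → w ∈ spanOf {x}ᶜ) : w ∈ spanOf A := by
  classical
  refine mem_spanOf_iff_forall_mem_toWord.2 fun p hp => ?_
  by_contra hA
  exact forall_mem_toWord_of_mem_spanOf (h p.1 hA) p hp rfl

theorem exists_eq_zpow_of_mem_spanOf_singleton {x : X} {w : FreeGroup X} (h : w ∈ spanOf {x}) :
    ∃ j : ℤ, of x ^ j = w := by
  rw [spanOf, Set.image_singleton] at h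
  exact Subgroup.mem_closure_singleton.1 h

theorem FreeAway.of_mem_spanOf_singleton {x : X} {q : FreeGroup X} (h : q ∈ spanOf {x}) :
    FreeAway x q := by
  intro w hw hwq
  have h1 : Subgroup.normalClosure {q} ≤ (keep {x}ᶜ).ker := by
    refine Subgroup.normalClosure_le_of_mem ?_
    have := map_mem_of_mem_spanOf (keep {x}ᶜ) ⊥ (by simp [keep]) h
    exact this
  rw [← keep_eq_self hw]
  exact h1 hwq

theorem SplitsPowers.zpow (x : X) {j : ℤ} (hj : j ≠ 0) : SplitsPowers (of x ^ j) := by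
  classical
  refine .of_ker_eq fun m hm => ?_
  let P := Multiplicative ℤ ⧸ Subgroup.zpowers (Multiplicative.ofAdd (j * m))
  let p : P := QuotientGroup.mk (Multiplicative.ofAdd 1)
  have hp : ∀ i : ℤ, p ^ i = 1 ↔ j * m ∣ i := by
    intro i
    have : p ^ i = QuotientGroup.mk (Multiplicative.ofAdd i) := by
      change QuotientGroup.mk (Multiplicative.ofAdd 1 ^ i) = _
      rw [← ofAdd_zsmul, smul_eq_mul, mul_one]
    rw [this, QuotientGroup.eq_one_iff, Subgroup.mem_zpowers_iff]
    constructor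
    · rintro ⟨k, hk⟩
      rw [← ofAdd_zsmul, smul_eq_mul] at hk
      exact ⟨k, by rw [mul_comm, ← Multiplicative.ofAdd.injective hk]⟩
    · rintro ⟨k, rfl⟩
      exact ⟨k, by rw [← ofAdd_zsmul, smul_eq_mul, mul_comm]⟩
  let α : Unit →* P := 1
  let β : Unit →* FreeGroup X := 1
  let N := Subgroup.normalClosure {(of x ^ j) ^ m}
  let T : FreeGroup X →* Amalgam α β := lift fun y =>
    if y = x then Amalgam.inl α β p else Amalgam.inr α β (of y)
  have hTx : T (of x) = Amalgam.inl α β p := by simp [T]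
  have hTq : ∀ i : ℤ, T (of x ^ i) = Amalgam.inl α β (p ^ i) := fun i => by
    rw [map_zpow, hTx, map_zpow]
  have hN : Subgroup.zpowers (Multiplicative.ofAdd (j * m)) ≤
      (zpowersHom (FreeGroup X ⧸ N) (QuotientGroup.mk (of x))).ker := by
    rw [Subgroup.zpowers_le, MonoidHom.mem_ker, zpowersHom_apply, toAdd_ofAdd, zpow_mul,
      zpow_natCast]
    exact (QuotientGroup.eq_one_iff ((of x ^ j) ^ m)).2 (Subgroup.self_mem_normalClosure _)
  obtain ⟨F, hF, hF'⟩ := Amalgam.exists_lift α β (QuotientGroup.lift _ _ hN)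
    (QuotientGroup.mk' N) (fun s => by simp [α, β])
  have hFT : F.comp T = QuotientGroup.mk' N := by
    refine FreeGroup.ext_hom _ _ fun y => ?_
    by_cases hy : y = x
    · subst hy
      rw [MonoidHom.comp_apply, hTx, hF]
      change zpowersHom _ _ _ = _
      simp
    · simp [T, hy, hF']
  refine ⟨_, _, T, le_antisymm ?_ (Subgroup.normalClosure_le_of_mem ?_), ?_⟩
  · change T.ker ≤ N
    rw [← QuotientGroup.ker_mk' N, ← hFT]
    intro y hy
    rw [MonoidHom.mem_ker, MonoidHom.comp_apply, (MonoidHom.mem_ker).1 hy, _root_.map_one]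
  · rw [MonoidHom.mem_ker, ← zpow_natCast, ← zpow_mul, hTq, (hp _).2 dvd_rfl, _root_.map_one]
  · rw [hTq]
    refine SplitsNormalClosure.inl ?_ (Function.injective_of_subsingleton _)
      (Function.injective_of_subsingleton _)
    refine ⟨P, inferInstance, p ^ j, (Subgroup.normalClosure {p ^ j}).subtype, ?_,
      fun x hx => (isConj_iff_eq.1 hx).symm, ?_⟩
    · have hord : ∀ i : ℕ, (p ^ j) ^ i = 1 ↔ m ∣ i := by
        intro i
        rw [← zpow_natCast, ← zpow_mul, hp, mul_dvd_mul_iff_left hj, Int.natCast_dvd_natCast]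
      exact Nat.dvd_antisymm (orderOf_dvd_of_pow_eq_one ((hord m).2 dvd_rfl))
        ((hord _).1 (pow_orderOf_eq_one _))
    · rw [Subgroup.ker_subtype]
      exact IsFreeGroup.of_injective (1 : _ →* FreeGroup Empty)
        (Function.injective_of_subsingleton _)

/-- Adds `j` to all indices. -/
def shift (j : ℤ) : FreeGroup (X × ℤ) →* FreeGroup (X × ℤ) := map fun p => (p.1, p.2 + j)

theorem norm_shift_le [DecidableEq X] (j : ℤ) (w : FreeGroup (X × ℤ)) :
    norm (shift j w) ≤ norm w := by
  conv_lhs => rw [← mk_toWord (x := w), shift, map.mk]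
  exact norm_mk_le.trans (List.length_map _).le

theorem shift_mem_spanOf {j : ℤ} {A B : Set (X × ℤ)} (h : ∀ p ∈ A, (p.1, p.2 + j) ∈ B)
    {w : FreeGroup (X × ℤ)} (hw : w ∈ spanOf A) : shift j w ∈ spanOf B :=
  map_mem_of_mem_spanOf _ _ (fun p hp => by
    rw [shift, map.of]
    exact of_mem_spanOf (h p hp)) hw

theorem unindex_shift {t : X} (j : ℤ) {w : FreeGroup (X × ℤ)}
    (hw : w ∈ spanOf {p : X × ℤ | p.1 ≠ t}) :
    unindex t (shift j w) = of t ^ j * unindex t w * (of t ^ j)⁻¹ := by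
  refine hom_eq_of_mem_spanOf ((unindex t).comp (shift j))
    ((MulAut.conj (of t ^ j)).toMonoidHom.comp (unindex t)) (fun p hp => ?_) hw
  change unindex t (shift j (of p)) = of t ^ j * unindex t (of p) * (of t ^ j)⁻¹
  rw [shift, map.of, unindex_of hp, unindex_of (p := (p.1, p.2 + j)) hp]
  group

/-- The homomorphism `s ↦ s ^ n` and `x ↦ x * s ^ e x` for `x ≠ s`. -/
noncomputable def twist [DecidableEq X] (s : X) (n : ℤ) (e : X → ℤ) :
    FreeGroup X →* FreeGroup X :=
  lift fun x => if x = s then of s ^ n else of x * of s ^ e x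

theorem twist_of_self [DecidableEq X] (s : X) (n : ℤ) (e : X → ℤ) :
    twist s n e (of s) = of s ^ n := by
  simp [twist]

theorem twist_of [DecidableEq X] {s x : X} (h : x ≠ s) (n : ℤ) (e : X → ℤ) :
    twist s n e (of x) = of x * of s ^ e x := by
  simp [twist, h]

theorem exists_twist_eq_unindex_mul [DecidableEq X] (s : X) (n : ℤ) (e : X → ℤ) (A : Set X)
    (L : List (X × Bool)) (hL : ∀ p ∈ L, p.1 ∈ A) :
    ∃ W ∈ spanOf {p : X × ℤ | p.1 ≠ s ∧ p.1 ∈ A}, norm W ≤ (L.filter (·.1 ≠ s)).length ∧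
      ∃ j : ℤ, twist s n e (mk L) = unindex s W * of s ^ j := by
  induction L with
  | nil => exact ⟨1, one_mem _, by simp, 0, by simp [← one_eq_mk]⟩
  | cons p L ih =>
    obtain ⟨W, hW, hn, j, hj⟩ := ih fun p hp => hL p (List.mem_cons_of_mem _ hp)
    obtain ⟨x, b⟩ := p
    have hxA : x ∈ A := hL _ List.mem_cons_self
    have hWs : W ∈ spanOf {p : X × ℤ | p.1 ≠ s} := spanOf_mono (fun p hp => hp.1) hW
    have hsh : ∀ i, shift i W ∈ spanOf {p : X × ℤ | p.1 ≠ s ∧ p.1 ∈ A} := fun i =>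
      shift_mem_spanOf (fun p hp => hp) hW
    have h1 : mk ((x, b) :: L) = mk [(x, b)] * mk L := by rw [mul_mk]; rfl
    have hinv : mk [(x, false)] = (of x)⁻¹ := by simp [of, inv_mk, invRev]
    rw [h1, _root_.map_mul, hj]
    by_cases hx : x = s
    · subst hx
      have hk : ∃ k : ℤ, twist x n e (mk [(x, b)]) = of x ^ k := by
        cases b
        · exact ⟨-n, by rw [hinv, _root_.map_inv, twist_of_self, zpow_neg]⟩
        · exact ⟨n, twist_of_self x n e⟩
      obtain ⟨k, hk⟩ := hk
      refine ⟨shift k W, hsh k, (norm_shift_le k W).trans (by simpa using hn), k + j, ?_⟩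
      rw [hk, unindex_shift k hWs, zpow_add]
      group
    · have hl : (((x, b) :: L).filter (·.1 ≠ s)).length = 1 + (L.filter (·.1 ≠ s)).length := by
        simp [hx, add_comm]
      have hof : ∀ i, of (x, i) ∈ spanOf {p : X × ℤ | p.1 ≠ s ∧ p.1 ∈ A} := fun i =>
        of_mem_spanOf ⟨hx, hxA⟩
      rw [hl]
      cases b
      · refine ⟨(of (x, -e x))⁻¹ * shift (-e x) W, mul_mem (inv_mem (hof _)) (hsh _),
          (norm_mul_le _ _).trans (Nat.add_le_add (by rw [norm_inv_eq, norm_of])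
            ((norm_shift_le _ W).trans hn)), -e x + j, ?_⟩
        rw [hinv, _root_.map_inv, twist_of hx, _root_.map_mul, _root_.map_inv,
          unindex_of (p := (x, -e x)) hx, unindex_shift _ hWs]
        group
      · refine ⟨of (x, 0) * shift (e x) W, mul_mem (hof _) (hsh _),
          (norm_mul_le _ _).trans (Nat.add_le_add (by rw [norm_of])
            ((norm_shift_le _ W).trans hn)), e x + j, ?_⟩
        change twist s n e (of x) * _ = _
        rw [twist_of hx, _root_.map_mul, unindex_of (p := (x, 0)) hx, unindex_shift _ hWs]
        group

theorem exists_window {t : X} (a : X) {W : FreeGroup (X × ℤ)}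
    (hW : W ∈ spanOf {p : X × ℤ | p.1 ≠ t}) :
    ∃ (j : ℤ) (k : ℕ), shift j W ∈ spanOf (window t a k) := by
  classical
  have h : ∃ j : ℤ, ∀ p ∈ W.toWord, |p.1.2| ≤ j := by
    obtain ⟨j, hj⟩ := ((W.toWord.map fun p => |p.1.2|).toFinset : Finset ℤ).bddAbove
    exact ⟨j, fun p hp => hj (List.mem_toFinset.2 (List.mem_map_of_mem hp))⟩
  obtain ⟨j, hj⟩ := h
  have hW' : W ∈ spanOf {p : X × ℤ | p.1 ≠ t ∧ |p.2| ≤ j} :=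
    mem_spanOf_iff_forall_mem_toWord.2 fun p hp =>
      ⟨forall_mem_toWord_of_mem_spanOf hW p hp, hj p hp⟩
  refine ⟨j, (2 * j + 1).toNat, shift_mem_spanOf (fun p hp => ?_) hW'⟩
  refine ⟨hp.1, fun _ => ?_⟩
  have := abs_le.1 hp.2
  simp only
  omega

theorem exists_minimal_window [DecidableEq X] {t a : X} (hta : a ≠ t) {q : FreeGroup X}
    (ha : Involves a q) {W : FreeGroup (X × ℤ)} (hW : W ∈ spanOf {p : X × ℤ | p.1 ≠ t})
    (hWq : IsConj q (unindex t W)) :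
    ∃ (k : ℕ) (Q : FreeGroup (X × ℤ)), 0 < k ∧ Q ∈ spanOf (window t a k) ∧
      IsConj q (unindex t Q) ∧ norm Q ≤ norm W ∧ Involves (a, 0) Q ∧ Involves (a, (k : ℤ) - 1) Q ∧
      ∀ p, Q ∈ spanOf {p}ᶜ ∨ Involves p Q := by
  classical
  let S : ℕ → FreeGroup (X × ℤ) → Prop := fun k Q =>
    Q ∈ spanOf (window t a k) ∧ IsConj q (unindex t Q) ∧ norm Q ≤ norm W
  have hex : ∃ k, ∃ Q, S k Q := by
    obtain ⟨j, k, h⟩ := exists_window a hW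
    exact ⟨k, _, h, hWq.trans (by
      rw [unindex_shift j hW]
      exact isConj_iff.2 ⟨_, rfl⟩), norm_shift_le j W⟩
  let k := Nat.find hex
  have hex' : ∃ n, ∃ Q, S k Q ∧ norm Q = n := by
    obtain ⟨Q, hQ⟩ := Nat.find_spec hex
    exact ⟨_, Q, hQ, rfl⟩
  obtain ⟨Q, ⟨hQ, hQq, hQn⟩, hQmin⟩ := Nat.find_spec hex'
  have hmin : ∀ k', k' < k → ∀ Q', ¬ S k' Q' := fun k' hk' Q' h => Nat.find_min hex hk' ⟨Q', h⟩
  have hk : 0 < k := by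
    by_contra h0
    refine ha _ hQq (map_mem_of_mem_spanOf _ _ (fun p hp => ?_) hQ)
    have hpa : p.1 ≠ a := fun h => by
      have := hp.2 h
      omega
    rw [unindex_of hp.1]
    have ht : of t ^ p.2 ∈ spanOf {a}ᶜ := zpow_mem (of_mem_spanOf hta.symm) _
    exact mul_mem (mul_mem ht (of_mem_spanOf hpa)) (inv_mem ht)
  refine ⟨k, Q, hk, hQ, hQq, hQn, ?_, ?_, fun p => ?_⟩
  · by_contra hinv
    have hc := isConj_keep_of_not_involves hinv
    have hmem := keep_mem_inter (A := {(a, 0)}ᶜ) hQ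
    refine hmin (k - 1) (by omega) (shift (-1) (keep {(a, 0)}ᶜ Q)) ⟨shift_mem_spanOf ?_ hmem,
      hQq.trans (((unindex t).map_isConj hc).trans ?_),
      (norm_shift_le _ _).trans ((norm_keep_le _ _).trans hQn)⟩
    · rintro ⟨x, i⟩ ⟨h1, h2, h3⟩
      refine ⟨h2, fun hx => ?_⟩
      have h4 := h3 hx
      have h5 : i ≠ 0 := fun hi => h1 (Prod.ext hx hi)
      simp only at h4 ⊢
      omega
    · rw [unindex_shift _ (spanOf_mono (fun p hp => hp.2.1) hmem)]
      exact isConj_iff.2 ⟨_, rfl⟩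
  · by_contra hinv
    have hc := isConj_keep_of_not_involves hinv
    have hmem := keep_mem_inter (A := {(a, (k : ℤ) - 1)}ᶜ) hQ
    refine hmin (k - 1) (by omega) (keep {(a, (k : ℤ) - 1)}ᶜ Q) ⟨spanOf_mono ?_ hmem,
      hQq.trans ((unindex t).map_isConj hc), (norm_keep_le _ _).trans hQn⟩
    rintro ⟨x, i⟩ ⟨h1, h2, h3⟩
    refine ⟨h2, fun hx => ?_⟩
    have h4 := h3 hx
    have h5 : i ≠ (k : ℤ) - 1 := fun hi => h1 (Prod.ext hx hi)
    simp only at h4 ⊢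
    omega
  · by_cases hinv : Involves p Q
    · exact Or.inr hinv
    · have hc := isConj_keep_of_not_involves hinv
      refine Or.inl (mem_spanOf_of_norm_keep ?_)
      rw [hQmin]
      exact Nat.find_min' hex' ⟨_, ⟨spanOf_mono Set.inter_subset_right (keep_mem_inter hQ),
        hQq.trans ((unindex t).map_isConj hc), (norm_keep_le _ _).trans hQn⟩, rfl⟩

end FreeGroup

namespace FreeGroup

variable {X : Type} [DecidableEq X]

theorem Involves.ne_one {X : Type} {x : X} {q : FreeGroup X} (h : Involves x q) : q ≠ 1 :=
  fun h1 => h q (IsConj.refl q) (h1 ▸ one_mem _)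

/-- The exponent sum of a basis element. -/
def expSum (x : X) : FreeGroup X →* Multiplicative ℤ :=
  lift fun y => if y = x then Multiplicative.ofAdd 1 else 1

theorem expSum_of_self (x : X) : expSum x (of x) = Multiplicative.ofAdd 1 := by simp [expSum]

theorem expSum_of {x y : X} (h : y ≠ x) : expSum x (of y) = 1 := by simp [expSum, h]

theorem expSum_eq_one_of_mem {x : X} {w : FreeGroup X} (h : w ∈ spanOf {x}ᶜ) : expSum x w = 1 :=
  hom_eq_of_mem_spanOf (expSum x) 1 (fun _ hy => expSum_of hy) h

theorem involves_of_expSum_ne_one {x : X} {q : FreeGroup X} (h : expSum x q ≠ 1) :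
    Involves x q := fun q' hq hq' => h (by
  rw [isConj_iff_eq.1 ((expSum x).map_isConj hq), expSum_eq_one_of_mem hq'])

theorem expSum_unindex {t : X} {W : FreeGroup (X × ℤ)} (hW : W ∈ spanOf {p : X × ℤ | p.1 ≠ t}) :
    expSum t (unindex t W) = 1 :=
  hom_eq_of_mem_spanOf ((expSum t).comp (unindex t)) 1 (fun p hp => by
    rw [MonoidHom.comp_apply, unindex_of hp, _root_.map_mul, _root_.map_mul, _root_.map_inv,
      expSum_of hp]
    simp) hW

/-- If the exponent sum of `t` in the twisted word vanishes, the word comes from an indexed one. -/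
theorem exists_twist_eq_unindex {s : X} (n : ℤ) (e : X → ℤ) {A : Set X} {w : FreeGroup X}
    (hw : w ∈ spanOf A) (h : expSum s (twist s n e w) = 1) :
    ∃ W ∈ spanOf {p : X × ℤ | p.1 ≠ s ∧ p.1 ∈ A},
      norm W ≤ (w.toWord.filter (·.1 ≠ s)).length ∧ twist s n e w = unindex s W := by
  obtain ⟨W, hW, hn, j, hj⟩ := exists_twist_eq_unindex_mul s n e A w.toWord
    (forall_mem_toWord_of_mem_spanOf hw)
  rw [mk_toWord] at hj
  refine ⟨W, hW, hn, ?_⟩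
  rw [hj, _root_.map_mul, expSum_unindex (spanOf_mono (fun p hp => hp.1) hW), one_mul,
    map_zpow, expSum_of_self, ← ofAdd_zsmul, smul_eq_mul, mul_one] at h
  have h0 : j = 0 := Multiplicative.ofAdd.injective h
  rw [hj, h0, zpow_zero, mul_one]

theorem twist_one_zero (s : X) : twist s 1 0 = MonoidHom.id (FreeGroup X) := by
  refine FreeGroup.ext_hom _ _ fun x => ?_
  by_cases hx : x = s
  · subst hx; simp [twist]
  · simp [twist, hx]

theorem splitsPowers_and_freeAway_of_unindex {t a : X} (hta : a ≠ t) {q : FreeGroup X}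
    (ha : Involves a q) {W : FreeGroup (X × ℤ)} (hW : W ∈ spanOf {p : X × ℤ | p.1 ≠ t})
    (hWq : IsConj q (unindex t W))
    (ih : ∀ Q : FreeGroup (X × ℤ), Q ≠ 1 → norm Q ≤ norm W →
      SplitsPowers Q ∧ ∀ p, Involves p Q → FreeAway p Q) :
    SplitsPowers q ∧ FreeAway a q ∧ (Involves t q → FreeAway t q) := by
  obtain ⟨k, Q, hk, hQ, hQq, hQn, h0, h1, hinv⟩ := exists_minimal_window hta ha hW hWq
  obtain ⟨hs, hf⟩ := ih Q h0.ne_one hQn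
  have hmem : ∀ v ∈ spanOf (window t a k), unindex t v ∈ Subgroup.normalClosure {q} →
      v ∈ Subgroup.normalClosure {Q} := fun v hv hvq =>
    mem_normalClosure_of_unindex hta hQ (hf _ h1) (hf _ h0) hv
      (Subgroup.normalClosure_eq_of_isConj hQq ▸ hvq)
  refine ⟨(SplitsPowers.unindex hta hQ (hf _ h1) (hf _ h0) hs).of_isConj hQq, fun w hw hwq => ?_,
    fun ht w hw hwq => ?_⟩
  · have hle : Subgroup.normalClosure {q} ≤ (expSum t).ker := by
      refine Subgroup.normalClosure_le_of_mem ?_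
      rw [MonoidHom.mem_ker, isConj_iff_eq.1 ((expSum t).map_isConj hWq), expSum_unindex hW]
    obtain ⟨v, hv, -, hvw⟩ := exists_twist_eq_unindex (s := t) 1 0 hw (by
      rw [twist_one_zero]; exact hle hwq)
    rw [twist_one_zero, MonoidHom.id_apply] at hvw
    have hvk : v ∈ spanOf (window t a k) :=
      spanOf_mono (by exact fun p hp => ⟨hp.1, fun h => absurd h hp.2⟩) hv
    have hva : v ∈ spanOf {(a, 0)}ᶜ :=
      spanOf_mono (by exact fun p hp h => hp.2 (congrArg Prod.fst h)) hv
    rw [hvw, hf _ h0 v hva (hmem v hvk (hvw ▸ hwq)), _root_.map_one]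
  · let v : FreeGroup (X × ℤ) := map (fun x => (x, 0)) w
    have hv : v ∈ spanOf {p : X × ℤ | p.1 ≠ t ∧ p.2 = 0} :=
      map_mem_of_mem_spanOf _ _ (fun x hx => by
        rw [map.of]
        exact of_mem_spanOf ⟨hx, rfl⟩) hw
    have hvw : unindex t v = w :=
      hom_eq_of_mem_spanOf ((unindex t).comp (map fun x => (x, 0))) (MonoidHom.id _)
        (fun x hx => by
          rw [MonoidHom.comp_apply, map.of, unindex_of (p := (x, 0)) hx]
          simp) hw
    have hvk : v ∈ spanOf (window t a k) := spanOf_mono (by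
      exact fun p hp => ⟨hp.1, fun _ => by
        rw [hp.2]
        exact ⟨le_rfl, by exact_mod_cast hk⟩⟩) hv
    have hvQ := hmem v hvk (hvw.symm ▸ hwq)
    have hp : ∃ p : X × ℤ, p.2 ≠ 0 ∧ Involves p Q := by
      by_contra! hno
      have hQ0 : Q ∈ spanOf {p : X × ℤ | p.1 ≠ t ∧ p.2 = 0} := by
        refine mem_spanOf_iff_forall_mem_toWord.2 fun p hp =>
          ⟨(forall_mem_toWord_of_mem_spanOf hQ p hp).1, ?_⟩
        by_contra hp0
        exact (hinv p.1).elim (fun h => forall_mem_toWord_of_mem_spanOf h p hp rfl) (hno p.1 hp0)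
      refine ht _ hQq (map_mem_of_mem_spanOf _ _ (fun p hp => ?_) hQ0)
      rw [unindex_of hp.1, hp.2]
      simpa using of_mem_spanOf (A := {t}ᶜ) hp.1
    obtain ⟨p, hp0, hp⟩ := hp
    have hvp : v ∈ spanOf {p}ᶜ := spanOf_mono (by
      rintro r hr rfl
      exact hp0 hr.2) hv
    rw [← hvw, hf p hp v hvp hvQ, _root_.map_one]

/-- Twisting reflects membership in the normal closure of an element modulo which `s` has infinite
order. -/
theorem mem_normalClosure_of_twist {s : X} {n : ℤ} (hn : n ≠ 0) (e : X → ℤ) {r f : FreeGroup X}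
    (hs : ∀ k : ℤ, of s ^ k ∈ Subgroup.normalClosure {r} → k = 0)
    (h : twist s n e f ∈ Subgroup.normalClosure {twist s n e r}) :
    f ∈ Subgroup.normalClosure {r} := by
  let α : Multiplicative ℤ →* OneRelator r := zpowersHom _ (QuotientGroup.mk (of s))
  let β : Multiplicative ℤ →* Multiplicative ℤ := zpowersHom _ (Multiplicative.ofAdd n)
  have hα : Function.Injective α := by
    rw [injective_iff_map_eq_one]
    intro k hk
    exact Multiplicative.toAdd.injective (hs k.toAdd ((QuotientGroup.eq_one_iff _).1 hk))
  have hβ : Function.Injective β := by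
    rw [injective_iff_map_eq_one]
    intro k hk
    have h1 : k.toAdd * n = 0 := by
      simpa [β, ← ofAdd_zsmul] using hk
    exact Multiplicative.toAdd.injective ((mul_eq_zero.1 h1).resolve_right hn)
  let σ : Amalgam α β := Amalgam.inr α β (Multiplicative.ofAdd 1)
  have hσ : σ ^ n = Amalgam.inl α β (QuotientGroup.mk (of s)) := by
    have := Amalgam.inl_apply_eq α β (Multiplicative.ofAdd 1)
    simp only [α, β, zpowersHom_apply, toAdd_ofAdd, zpow_one] at this
    rw [this, ← map_zpow, ← ofAdd_zsmul, smul_eq_mul, mul_one]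
  let T : FreeGroup X →* Amalgam α β := lift fun x =>
    if x = s then σ else Amalgam.inl α β (QuotientGroup.mk (of x)) * (σ ^ e x)⁻¹
  have hT : ∀ w, T (twist s n e w) = Amalgam.inl α β (QuotientGroup.mk w) := by
    have : T.comp (twist s n e) = (Amalgam.inl α β).comp (QuotientGroup.mk' _) := by
      refine FreeGroup.ext_hom _ _ fun x => ?_
      have hTs : T (of s) = σ := by simp [T]
      by_cases hx : x = s
      · subst hx
        rw [MonoidHom.comp_apply, twist_of_self, map_zpow, hTs, hσ]
        rfl
      · rw [MonoidHom.comp_apply, twist_of hx, _root_.map_mul, map_zpow, hTs]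
        simp [T, hx]
    exact DFunLike.congr_fun this
  have hker : Subgroup.normalClosure {twist s n e r} ≤ T.ker := by
    refine Subgroup.normalClosure_le_of_mem ?_
    rw [MonoidHom.mem_ker, hT, (QuotientGroup.eq_one_iff _).2 (Subgroup.self_mem_normalClosure r),
      _root_.map_one]
  have h1 := (MonoidHom.mem_ker).1 (hker h)
  rw [hT, ← _root_.map_one (Amalgam.inl α β)] at h1
  exact (QuotientGroup.eq_one_iff f).1 (Amalgam.inl_injective hα hβ h1)

theorem length_filter_ne_lt_norm {x : X} {q : FreeGroup X} (h : Involves x q) :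
    (q.toWord.filter (·.1 ≠ x)).length < norm q := by
  by_contra hlt
  have h1 := List.length_filter_eq_length_iff.1
    (le_antisymm (List.length_filter_le (·.1 ≠ x) q.toWord) (not_lt.1 hlt))
  refine h q (IsConj.refl q) (mem_spanOf_iff_forall_mem_toWord.2 fun p hp => ?_)
  simpa using h1 p hp

theorem expSum_twist {x s : X} (hxs : x ≠ s) (n b : ℤ) (w : FreeGroup X) :
    expSum s (twist s n (Pi.single x b) w) = expSum s w ^ n * expSum x w ^ b := by
  have : (expSum s).comp (twist s n (Pi.single x b)) =
      (zpowGroupHom n).comp (expSum s) * (zpowGroupHom b).comp (expSum x) := by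
    refine FreeGroup.ext_hom _ _ fun y => ?_
    by_cases hys : y = s
    · subst hys
      simp [twist_of_self, expSum_of hxs.symm]
    · by_cases hyx : y = x
      · subst hyx
        simp [twist_of hys, expSum_of hys, expSum_of_self]
      · simp [twist_of hys, expSum_of hys, expSum_of hyx, hyx]
  exact DFunLike.congr_fun this w

theorem expSum_twist_of_ne {x s : X} (hxs : x ≠ s) (n : ℤ) (e : X → ℤ) (w : FreeGroup X) :
    expSum x (twist s n e w) = expSum x w := by
  have : (expSum x).comp (twist s n e) = expSum x := by
    refine FreeGroup.ext_hom _ _ fun y => ?_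
    by_cases hys : y = s
    · subst hys
      simp [twist_of_self, expSum_of hxs.symm]
    · simp [twist_of hys, expSum_of hxs.symm]
  exact DFunLike.congr_fun this w

theorem twist_mem_spanOf_compl {x s : X} (hxs : x ≠ s) (n : ℤ) (e : X → ℤ) {w : FreeGroup X}
    (hw : w ∈ spanOf {x}ᶜ) : twist s n e w ∈ spanOf {x}ᶜ := by
  have hs : ∀ k : ℤ, of s ^ k ∈ spanOf {x}ᶜ := fun k => zpow_mem (of_mem_spanOf hxs.symm) k
  refine map_mem_of_mem_spanOf _ _ (fun y hy => ?_) hw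
  by_cases hys : y = s
  · subst hys
    rw [twist_of_self]
    exact hs n
  · rw [twist_of hys]
    exact mul_mem (of_mem_spanOf hy) (hs _)

theorem eq_zero_of_zpow_mem_normalClosure {s : X} {n : ℤ} (hn : n ≠ 0) {e : X → ℤ}
    {r : FreeGroup X} (hr : expSum s (twist s n e r) = 1) (k : ℤ)
    (h : of s ^ k ∈ Subgroup.normalClosure {r}) : k = 0 := by
  have hle : Subgroup.normalClosure {r} ≤ ((expSum s).comp (twist s n e)).ker :=
    Subgroup.normalClosure_le_of_mem hr
  have h1 := (MonoidHom.mem_ker).1 (hle h)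
  rw [map_zpow, MonoidHom.comp_apply, twist_of_self, map_zpow, expSum_of_self, ← ofAdd_zsmul,
    ← ofAdd_zsmul] at h1
  have h2 : k * (n * 1) = 0 := Multiplicative.ofAdd.injective h1
  simpa [hn] using h2

theorem splitsPowers_and_freeAway_of_involves {q : FreeGroup X} {x y : X} (hxy : x ≠ y)
    (hx : Involves x q) (hy : Involves y q)
    (ih : ∀ Q : FreeGroup (X × ℤ), Q ≠ 1 → norm Q < norm q →
      SplitsPowers Q ∧ ∀ p, Involves p Q → FreeAway p Q) :
    SplitsPowers q ∧ FreeAway x q := by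
  by_cases hq : expSum x q = 1
  · obtain ⟨W, hW, hWn, hWq⟩ := exists_twist_eq_unindex (s := x) 1 0 (mem_spanOf_univ q) (by
      rwa [twist_one_zero])
    rw [twist_one_zero, MonoidHom.id_apply] at hWq
    obtain ⟨hs, -, hf⟩ := splitsPowers_and_freeAway_of_unindex hxy.symm hy
      (spanOf_mono (fun p hp => hp.1) hW) (hWq ▸ IsConj.refl q) fun Q hQ hQn =>
        ih Q hQ ((hQn.trans hWn).trans_lt (length_filter_ne_lt_norm hx))
    exact ⟨hs, hf hx⟩
  · let n : ℤ := (expSum x q).toAdd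
    let b : ℤ := (expSum y q).toAdd
    let ρ := twist y n (Pi.single x (-b))
    have hn : n ≠ 0 := fun h => hq (Multiplicative.toAdd.injective h)
    have hρ : expSum y (ρ q) = 1 := by
      rw [expSum_twist hxy]
      refine Multiplicative.toAdd.injective ?_
      rw [toAdd_mul, toAdd_zpow, toAdd_zpow, toAdd_one, smul_eq_mul, smul_eq_mul]
      change n * b + -b * n = 0
      ring
    have hmem : ∀ r f, expSum y (ρ r) = 1 → ρ f ∈ Subgroup.normalClosure {ρ r} →
        f ∈ Subgroup.normalClosure {r} := fun r f hr =>
      mem_normalClosure_of_twist hn _ (eq_zero_of_zpow_mem_normalClosure hn hr)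
    have hle : ∀ r, Subgroup.normalClosure {r} ≤ (Subgroup.normalClosure {ρ r}).comap ρ :=
      fun r => Subgroup.normalClosure_le_of_mem (Subgroup.self_mem_normalClosure (ρ r))
    obtain ⟨W, hW, hWn, hWq⟩ := exists_twist_eq_unindex n _ (mem_spanOf_univ q) hρ
    have hxρ : Involves x (ρ q) := involves_of_expSum_ne_one (by
      rwa [expSum_twist_of_ne hxy])
    obtain ⟨hs, hf, -⟩ := splitsPowers_and_freeAway_of_unindex hxy hxρ
      (spanOf_mono (fun p hp => hp.1) hW) (hWq ▸ IsConj.refl (ρ q)) fun Q hQ hQn =>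
        ih Q hQ ((hQn.trans hWn).trans_lt (length_filter_ne_lt_norm hy))
    constructor
    · refine .of_ker_eq fun m hm =>
        ⟨_, _, (QuotientGroup.mk' (Subgroup.normalClosure {ρ q ^ m})).comp ρ, ?_, hs m hm⟩
      rw [← MonoidHom.comap_ker, QuotientGroup.ker_mk', ← _root_.map_pow]
      refine le_antisymm (fun f hf => hmem _ f ?_ hf) (hle _)
      rw [_root_.map_pow, _root_.map_pow, hρ, one_pow]
    · intro w hw hwq
      have h1 := hf _ (twist_mem_spanOf_compl hxy _ _ hw) (hle q hwq)
      have h2 := hmem 1 w (by rw [_root_.map_one, _root_.map_one]) (by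
        rw [h1]; exact one_mem _)
      rwa [Subgroup.normalClosure_one, Subgroup.mem_bot] at h2

theorem splitsPowers_and_freeAway (N : ℕ) : ∀ {X : Type} [DecidableEq X] (q : FreeGroup X),
    q ≠ 1 → norm q < N → SplitsPowers q ∧ ∀ x, Involves x q → FreeAway x q := by
  induction N with
  | zero => exact fun q _ h => absurd h (Nat.not_lt_zero _)
  | succ N ih =>
    intro X _ q hq hqN
    obtain ⟨q', hc, hn, hinv⟩ := exists_isConj_forall_mem_or_involves q
    have hq' : q' ≠ 1 := by
      rintro rfl
      exact hq (isConj_one_left.1 hc)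
    have key : ∀ x, Involves x q' → SplitsPowers q' ∧ FreeAway x q' := by
      intro x hx
      by_cases hy : ∃ y, x ≠ y ∧ Involves y q'
      · obtain ⟨y, hxy, hy⟩ := hy
        exact splitsPowers_and_freeAway_of_involves hxy hx hy fun Q hQ hQn =>
          ih Q hQ (by omega)
      · have hqx : q' ∈ spanOf {x} := mem_spanOf_of_forall_not_mem fun y hyx =>
          (hinv y).resolve_right fun h => hy ⟨y, fun h' => hyx h'.symm, h⟩
        refine ⟨?_, .of_mem_spanOf_singleton hqx⟩
        obtain ⟨j, rfl⟩ := exists_eq_zpow_of_mem_spanOf_singleton hqx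
        exact .zpow x fun hj => hq' (by rw [hj, zpow_zero])
    have hex : ∃ x, Involves x q' := by
      by_contra! hno
      have h1 : q' ∈ spanOf (∅ : Set X) :=
        mem_spanOf_of_forall_not_mem fun x _ => (hinv x).resolve_right (hno x)
      rw [spanOf, Set.image_empty, Subgroup.closure_empty, Subgroup.mem_bot] at h1
      exact hq' h1
    obtain ⟨x, hx⟩ := hex
    exact ⟨(key x hx).1.of_isConj hc, fun y hy => (key y (hy.of_isConj hc)).2.of_isConj hc⟩

end FreeGroup

/-- Let `F` be the free group on `X`, `q ∈ F` nontrivial and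
not a proper power, `m` a positive integer, and `G = F/⟪q^m⟫` the one-relator
group with relator `q^m` (encoded by a surjection `π` with kernel `⟪q^m⟫`).
Let `c = π q`, `C = ⟨c⟩`, and let `H` be the normal closure of `c` in `G`.
Then `C` has order `m` and `H` has a normal free subgroup `K` with
`K ∩ C = 1` and `K·C = H`; that is, `H = K ⋊ C`. -/
theorem one_relator_normalClosure_semidirect
    (X : Type) (q : FreeGroup X) (hq1 : q ≠ 1)
    (hqnp : ∀ (y : FreeGroup X) (k : ℕ), 0 < k → q = y ^ k → k = 1)
    (m : ℕ) (hm : 0 < m)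
    (G : Type) [Group G] (π : FreeGroup X →* G)
    (hπ : Function.Surjective π) (hker : π.ker = Subgroup.normalClosure {q ^ m}) :
    orderOf (π q) = m ∧
    ∃ K : Subgroup ↥(Subgroup.normalClosure ({π q} : Set G)),
      K.Normal ∧ IsFreeGroup ↥K ∧
      K ⊓ Subgroup.zpowers
          (⟨π q, Subgroup.subset_normalClosure (Set.mem_singleton _)⟩ :
            ↥(Subgroup.normalClosure ({π q} : Set G))) = ⊥ ∧
      K ⊔ Subgroup.zpowers
          (⟨π q, Subgroup.subset_normalClosure (Set.mem_singleton _)⟩ :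
            ↥(Subgroup.normalClosure ({π q} : Set G))) = ⊤ := by
  classical
  have h := (FreeGroup.splitsPowers_and_freeAway _ q hq1 (Nat.lt_succ_self _)).1 m hm
  refine (FreeGroup.splitsNormalClosure_of_ker_eq hπ
    (QuotientGroup.mk' _) ?_ h).exists_complement ?_
  · rw [QuotientGroup.ker_mk', hker]
  · rw [← map_pow, ← MonoidHom.mem_ker, hker]
    exact Subgroup.self_mem_normalClosure _
end

section
/- Let G be a group and let Z and U be nonzero rings such that the group ring ZG is a subring of U and every nonzero element of ZG is invertible in U. Let n be a positive integer, and suppose given an exact sequence of left ZG-modules ⋯ → P_{n+1} →^{d_{n+1}} P_n →^{d_n} P_{n−1} → ⋯ → P₀ → Z → 0 in which every P_k is projective, Z is the trivial ZG-module, and P_n = (ZG)². Then either d_{n+1} is the zero map, or the induced sequence U ⊗_{ZG} P_{n+1} → U ⊗_{ZG} P_n → U ⊗_{ZG} P_{n−1} is exact at U ⊗_{ZG} P_n (that is, H_n(G; U) = 0). -/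
/-- The augmentation ring homomorphism `ZG → Z`, sending each group element
to `1`. -/
noncomputable def augmentationRingHom (Z : Type) [Ring Z] (G : Type) [Group G] :
    MonoidAlgebra Z G →+* Z :=
  MonoidAlgebra.liftNCRingHom (RingHom.id Z) 1 (fun _ _ => Commute.one_right _)

/-- The trivial left `ZG`-module `Z`: `Z` with each element of `G` acting as
the identity, i.e. with the `ZG`-action given by the augmentation. -/
def TrivialModule (Z : Type) [Ring Z] (G : Type) [Group G] : Type := Z

instance (Z : Type) [Ring Z] (G : Type) [Group G] :
    AddCommGroup (TrivialModule Z G) :=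
  inferInstanceAs (AddCommGroup Z)

noncomputable instance (Z : Type) [Ring Z] (G : Type) [Group G] :
    Module (MonoidAlgebra Z G) (TrivialModule Z G) :=
  Module.compHom Z (augmentationRingHom Z G)

/-- The augmentation `ZG → Z` as a map of left `ZG`-modules onto the trivial
module. -/
noncomputable def augmentationLinearMap (Z : Type) [Ring Z] (G : Type) [Group G] :
    MonoidAlgebra Z G →ₗ[MonoidAlgebra Z G] TrivialModule Z G where
  toFun x := (augmentationRingHom Z G x : TrivialModule Z G)
  map_add' x y := map_add _ x y
  map_smul' a x := by
    show augmentationRingHom Z G (a * x) =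
      augmentationRingHom Z G a • augmentationRingHom Z G x
    rw [map_mul]
    rfl

/-- `b : U → M → T` realizes the base-changed module `U ⊗_{ZG} M` (for `U` a
ring containing the image of `A = ZG` under `φ`, `M` a left `A`-module and `T`
a left `U`-module): `b` is biadditive, `A`-balanced and `U`-linear in the
first variable, and is universal among such maps into left `U`-modules. -/
def IsInducedTensor {A U : Type} [Ring A] [Ring U] (φ : A →+* U)
    {M : Type} [AddCommGroup M] [Module A M]
    {T : Type} [AddCommGroup T] [Module U T] (b : U → M → T) : Prop :=
  (∀ u u' m, b (u + u') m = b u m + b u' m) ∧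
  (∀ u m m', b u (m + m') = b u m + b u m') ∧
  (∀ u a m, b (u * φ a) m = b u (a • m)) ∧
  (∀ u' u m, b (u' * u) m = u' • b u m) ∧
  ∀ (T' : Type) (_ : AddCommGroup T') (_ : Module U T') (b' : U → M → T'),
    (∀ u u' m, b' (u + u') m = b' u m + b' u' m) →
    (∀ u m m', b' u (m + m') = b' u m + b' u m') →
    (∀ u a m, b' (u * φ a) m = b' u (a • m)) →
    (∀ u' u m, b' (u' * u) m = u' • b' u m) →
    ∃! g : T →ₗ[U] T', ∀ u m, g (b u m) = b' u m

namespace IsInducedTensor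

variable {A U : Type} [Ring A] [Ring U] {φ : A →+* U}
  {M : Type} [AddCommGroup M] [Module A M] {T : Type} [AddCommGroup T] [Module U T]
  {b : U → M → T}

theorem map_zero_right (hb : IsInducedTensor φ b) (u : U) : b u 0 = 0 := by
  have h := hb.2.1 u 0 0
  rw [add_zero] at h
  exact left_eq_add.mp h

/-- The elementary tensors span the induced module. -/
theorem span_eq_top (hb : IsInducedTensor φ b) :
    Submodule.span U {t | ∃ u m, t = b u m} = ⊤ := by
  set S := Submodule.span U {t | ∃ u m, t = b u m} with hS
  obtain ⟨g, -, hg⟩ := hb.2.2.2.2 (T ⧸ S) inferInstance inferInstance (fun _ _ => 0)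
    (by simp) (by simp) (by simp) (by simp)
  have h₁ := hg S.mkQ fun u m => by
    rw [Submodule.mkQ_apply, Submodule.Quotient.mk_eq_zero]
    exact Submodule.subset_span ⟨u, m, rfl⟩
  have h₂ := hg 0 fun u m => rfl
  rw [← S.ker_mkQ, h₁, ← h₂, LinearMap.ker_zero]

/-- A submodule of the induced module containing all elementary tensors contains everything. -/
theorem mem_of_forall_mem (hb : IsInducedTensor φ b) (N : Submodule U T)
    (h : ∀ u m, b u m ∈ N) (t : T) : t ∈ N := by
  have : Submodule.span U {t | ∃ u m, t = b u m} ≤ N := by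
    rw [Submodule.span_le]
    rintro _ ⟨u, m, rfl⟩
    exact h u m
  exact this (hb.span_eq_top ▸ Submodule.mem_top)

/-- If `x` and `y` generate `M`, every element of `U ⊗ M` is of the form `u ⊗ x + v ⊗ y`. -/
theorem exists_eq_add (hb : IsInducedTensor φ b) {x y : M}
    (hxy : ∀ m, ∃ r s : A, m = r • x + s • y) (t : T) :
    ∃ u v, t = b u x + b v y := by
  have hb' := hb
  obtain ⟨hadd, hadd', hbal, hlin, -⟩ := hb'
  let N : Submodule U T :=
    { carrier := {t | ∃ u v, t = b u x + b v y}
      add_mem' := by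
        rintro _ _ ⟨u, v, rfl⟩ ⟨u', v', rfl⟩
        exact ⟨u + u', v + v', by rw [hadd, hadd]; abel⟩
      zero_mem' := ⟨0, 0, by
        have h : ∀ m, b 0 m = 0 := fun m => by simpa using hlin 0 0 m
        rw [h, h, add_zero]⟩
      smul_mem' := by
        rintro c _ ⟨u, v, rfl⟩
        exact ⟨c * u, c * v, by rw [hlin, hlin, smul_add]⟩ }
  refine hb.mem_of_forall_mem N (fun u m => ?_) t
  obtain ⟨r, s, rfl⟩ := hxy m
  exact ⟨u * φ r, u * φ s, by rw [hadd', hbal, hbal]⟩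

/-- A linear functional `f` on `M` induces the functional `u ⊗ m ↦ u * φ (f m)` on `U ⊗ M`. -/
theorem exists_functional (hb : IsInducedTensor φ b) (f : M →ₗ[A] A) :
    ∃ g : T →ₗ[U] U, ∀ u m, g (b u m) = u * φ (f m) :=
  (hb.2.2.2.2 U inferInstance inferInstance (fun u m => u * φ (f m))
    (fun _ _ _ => add_mul _ _ _) (fun _ _ _ => by rw [map_add, map_add, mul_add])
    (fun _ _ _ => by rw [map_smul, smul_eq_mul, map_mul, mul_assoc])
    (fun _ _ _ => by rw [mul_assoc, smul_eq_mul])).exists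

end IsInducedTensor

/-- Linear functionals on a projective module separate points from zero. -/
theorem Module.Projective.exists_functional_ne_zero {A M : Type*} [Ring A] [AddCommGroup M]
    [Module A M] [Module.Projective A M] {m : M} (hm : m ≠ 0) :
    ∃ f : M →ₗ[A] A, f m ≠ 0 := by
  obtain ⟨s, hs⟩ := Module.projective_def'.mp ‹Module.Projective A M›
  by_contra! h
  have hsm : s m = 0 := Finsupp.ext fun i => h ((Finsupp.lapply i).comp s)
  apply hm
  simpa [hsm] using (LinearMap.congr_fun hs m).symm

namespace IsInducedTensor

variable {A U : Type} [Ring A] [Ring U] {φ : A →+* U}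
  {M : Type} [AddCommGroup M] [Module A M] {T : Type} [AddCommGroup T] [Module U T]
  {b : U → M → T}

/-- If nonzero elements of `A` become invertible in `U` and `m` is a nonzero element of a
projective module, then `u ⊗ m` vanishes only for `u = 0`. -/
theorem eq_zero_of_apply_eq_zero [Module.Projective A M] (hb : IsInducedTensor φ b)
    (hunit : ∀ a : A, a ≠ 0 → IsUnit (φ a)) {u : U} {m : M} (hm : m ≠ 0)
    (h : b u m = 0) : u = 0 := by
  obtain ⟨f, hf⟩ := Module.Projective.exists_functional_ne_zero (A := A) hm
  obtain ⟨g, hg⟩ := hb.exists_functional f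
  have := hg u m
  rw [h, map_zero] at this
  exact (hunit _ hf).mul_left_eq_zero.mp this.symm

variable {L N : Type} [AddCommGroup L] [Module A L] [AddCommGroup N] [Module A N]
  {TL TN : Type} [AddCommGroup TL] [Module U TL] [AddCommGroup TN] [Module U TN]
  {bL : U → L → TL} {bN : U → N → TN}

/-- Exactness of `U ⊗ L → U ⊗ M → U ⊗ N` when `M` is generated by two elements `x`, `y` and
the image of `L → M` contains some `r • x + s • y` with `r ≠ 0`. -/
theorem exact_of_apply_eq_smul_add_smul [Nontrivial U] [Module.Projective A N]
    (hunit : ∀ a : A, a ≠ 0 → IsUnit (φ a))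
    (hL : IsInducedTensor φ bL) (hM : IsInducedTensor φ b) (hN : IsInducedTensor φ bN)
    {f : L →ₗ[A] M} {g : M →ₗ[A] N} (hfg : Function.Exact f g)
    {F : TL →ₗ[U] T} {H : T →ₗ[U] TN}
    (hF : ∀ u p, F (bL u p) = b u (f p)) (hH : ∀ u p, H (b u p) = bN u (g p))
    {x y : M} (hxy : ∀ m, ∃ r s : A, m = r • x + s • y)
    {l : L} {r s : A} (hl : f l = r • x + s • y) (hr : r ≠ 0) :
    Function.Exact F H := by
  have hcomp : ∀ t, H (F t) = 0 := hL.mem_of_forall_mem (LinearMap.ker (H ∘ₗ F)) fun u p => by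
    rw [LinearMap.mem_ker, LinearMap.comp_apply, hF, hH, hfg.apply_apply_eq_zero,
      hN.map_zero_right]
  intro t
  refine ⟨fun ht => ?_, ?_⟩
  swap
  · rintro ⟨z, rfl⟩
    exact hcomp z
  obtain ⟨u, v, rfl⟩ := hM.exists_eq_add hxy t
  obtain ⟨c, hc⟩ := hunit r hr
  set w : U := v - u * ↑c⁻¹ * φ s with hw
  have key : b u x + b v y = F (bL (u * ↑c⁻¹) l) + b w y := by
    rw [hF, hl, hM.2.1, ← hM.2.2.1, ← hM.2.2.1, add_assoc, ← hM.1, ← hc,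
      Units.inv_mul_cancel_right, hw, add_sub_cancel]
  rw [key, map_add, hcomp, zero_add, hH] at ht
  rw [key]
  suffices b w y ∈ Set.range F by
    obtain ⟨z, hz⟩ := this
    exact ⟨bL (u * ↑c⁻¹) l + z, by rw [map_add, hz]⟩
  by_cases hy : g y = 0
  · have hx : g x = 0 := by
      by_contra hx
      have h := hfg.apply_apply_eq_zero l
      rw [hl, map_add, map_smul, map_smul, hy, smul_zero, add_zero] at h
      have h' : bN (1 * φ r) (g x) = 0 := by rw [hN.2.2.1, h, hN.map_zero_right]
      have h0 := hN.eq_zero_of_apply_eq_zero hunit hx h'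
      rw [one_mul] at h0
      exact (hunit r hr).ne_zero h0
    obtain ⟨q, hq⟩ := (hfg y).mp hy
    exact ⟨bL w q, by rw [hF, hq]⟩
  · rw [hN.eq_zero_of_apply_eq_zero hunit hy ht]
    refine ⟨0, ?_⟩
    have := hM.2.2.2.1 0 0 y
    rw [zero_smul, zero_mul] at this
    rw [map_zero, this]

end IsInducedTensor

/-- Let `Z`, `U` be nonzero rings with `ZG` a subring of `U`
(via an injective ring homomorphism `φ`) such that every nonzero element of
`ZG` becomes invertible in `U`.  Let `n = j + 1` be a positive integer and let
`⋯ → P_{k+1} → P_k → ⋯ → P₀ → Z → 0` be an exact sequence of projective left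
`ZG`-modules augmented over the trivial module, with `P_n = (ZG)²`.  If the
base changes `T_k = U ⊗_{ZG} P_k` (presented by universal balanced maps
`b_k`) and the induced maps `D_k` are given, then either `d_{n+1} = 0` or the
induced sequence `T_{n+1} → T_n → T_{n−1}` is exact at `T_n`
(that is, `H_n(G; U) = 0`). -/
theorem homology_vanishes_or_zero_map
    (G Z U : Type) [Group G] [Ring Z] [Ring U] [Nontrivial Z] [Nontrivial U]
    (φ : MonoidAlgebra Z G →+* U) (hφinj : Function.Injective φ)
    (hunit : ∀ a : MonoidAlgebra Z G, a ≠ 0 → IsUnit (φ a))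
    (j : ℕ)
    (P : ℕ → Type) [∀ k, AddCommGroup (P k)] [∀ k, Module (MonoidAlgebra Z G) (P k)]
    (hproj : ∀ k, Module.Projective (MonoidAlgebra Z G) (P k))
    (d : ∀ k, P (k + 1) →ₗ[MonoidAlgebra Z G] P k)
    (ε : P 0 →ₗ[MonoidAlgebra Z G] TrivialModule Z G)
    (hεsurj : Function.Surjective ε)
    (hex0 : Function.Exact (d 0) ε)
    (hexact : ∀ k, Function.Exact (d (k + 1)) (d k))
    (ePn : Nonempty (P (j + 1) ≃ₗ[MonoidAlgebra Z G] (Fin 2 → MonoidAlgebra Z G)))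
    (T : ℕ → Type) [∀ k, AddCommGroup (T k)] [∀ k, Module U (T k)]
    (b : ∀ k, U → P k → T k) (hb : ∀ k, IsInducedTensor φ (b k))
    (D : ∀ k, T (k + 1) →ₗ[U] T k)
    (hD : ∀ k u p, D k (b (k + 1) u p) = b k u (d k p)) :
    d (j + 1) = 0 ∨ Function.Exact (D (j + 1)) (D j) := by
  obtain ⟨e⟩ := ePn
  rw [or_iff_not_imp_left]
  intro hd
  obtain ⟨l, hl⟩ : ∃ l, d (j + 1) l ≠ 0 := by
    by_contra! h
    exact hd (LinearMap.ext h)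
  have hgen : ∀ m, m = e m 0 • e.symm (Pi.single 0 1) + e m 1 • e.symm (Pi.single 1 1) := by
    intro m
    apply e.injective
    ext i : 1
    fin_cases i <;> simp
  have := hproj j
  by_cases h0 : e (d (j + 1) l) 0 = 0
  · have h1 : e (d (j + 1) l) 1 ≠ 0 := by
      intro h1
      apply hl
      rw [hgen (d (j + 1) l), h0, h1, zero_smul, zero_smul, add_zero]
    exact IsInducedTensor.exact_of_apply_eq_smul_add_smul hunit (hb _) (hb _) (hb _)
      (hexact j) (hD _) (hD _) (fun m => ⟨_, _, (hgen m).trans (add_comm _ _)⟩)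
      ((hgen _).trans (add_comm _ _)) h1
  · exact IsInducedTensor.exact_of_apply_eq_smul_add_smul hunit (hb _) (hb _) (hb _)
      (hexact j) (hD _) (hD _) (fun m => ⟨_, _, hgen m⟩) (hgen _) h0
end

section
/- Let G be a group and let Z and U be nonzero rings such that the group ring ZG is a subring of U and every nonzero element of ZG is invertible in U. Suppose there exists an exact sequence of left ZG-modules ⋯ →^{∂₃} (ZG)² →^{∂₂} (ZG)² →^{∂₁} (ZG)² →^{∂₀} ZG →^{ε} Z → 0, where ε is the augmentation map and all the maps ∂_k are nonzero. Then the complex obtained by applying U ⊗_{ZG} − to the unaugmented complex ⋯ → (ZG)² → (ZG)² → (ZG)² → ZG → 0 is exact in every degree; that is, H_n(G; U) = 0 for all n ≥ 0. -/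
/-- The map `Uⁿ → Uᵐ` induced, after applying `U ⊗_A −` along `φ : A →+* U`,
by an `A`-linear map `Aⁿ → Aᵐ`: right multiplication by the image under `φ`
of the matrix of `d`. -/
noncomputable def baseChangeMap {A U : Type} [Ring A] [Ring U] (φ : A →+* U)
    {n m : ℕ} (d : (Fin n → A) →ₗ[A] (Fin m → A)) :
    (Fin n → U) →ₗ[U] (Fin m → U) where
  toFun w := fun j => ∑ i, w i * φ (d (Pi.single i 1) j)
  map_add' u v := by funext j; simp [add_mul, Finset.sum_add_distrib]
  map_smul' a v := by funext j; simp [Finset.mul_sum, smul_eq_mul, mul_assoc]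

/-- The map `Uⁿ → U` induced, after applying `U ⊗_A −` along `φ : A →+* U`,
by an `A`-linear map `Aⁿ → A`. -/
noncomputable def baseChangeMapTo {A U : Type} [Ring A] [Ring U] (φ : A →+* U)
    {n : ℕ} (d : (Fin n → A) →ₗ[A] A) : (Fin n → U) →ₗ[U] U where
  toFun w := ∑ i, w i * φ (d (Pi.single i 1))
  map_add' u v := by simp [add_mul, Finset.sum_add_distrib]
  map_smul' a v := by simp [Finset.mul_sum, smul_eq_mul, mul_assoc]

section BaseChange

variable {A U : Type} [Ring A] [Ring U] (φ : A →+* U)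

theorem LinearMap.apply_eq_sum_smul_single {M : Type} [AddCommGroup M] [Module A M] {n : ℕ}
    (d : (Fin n → A) →ₗ[A] M) (x : Fin n → A) : d x = ∑ i, x i • d (Pi.single i 1) := by
  simp_rw [← map_smul, ← map_sum, ← Pi.single_smul, smul_eq_mul, mul_one, Finset.univ_sum_single]

theorem baseChangeMap_single {n m : ℕ} (d : (Fin n → A) →ₗ[A] (Fin m → A)) (i : Fin n) (u : U) :
    baseChangeMap φ d (Pi.single i u) = u • (φ ∘ d (Pi.single i 1)) := by
  funext j
  simp [baseChangeMap, Pi.single_apply]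

theorem baseChangeMapTo_single {n : ℕ} (d : (Fin n → A) →ₗ[A] A) (i : Fin n) (u : U) :
    baseChangeMapTo φ d (Pi.single i u) = u * φ (d (Pi.single i 1)) := by
  simp [baseChangeMapTo, Pi.single_apply]

theorem baseChangeMap_comp_coe {n m : ℕ} (d : (Fin n → A) →ₗ[A] (Fin m → A)) (x : Fin n → A) :
    baseChangeMap φ d (φ ∘ x) = φ ∘ d x := by
  funext j
  simp [LinearMap.apply_eq_sum_smul_single d x, baseChangeMap]

theorem baseChangeMapTo_comp_coe {n : ℕ} (d : (Fin n → A) →ₗ[A] A) (x : Fin n → A) :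
    baseChangeMapTo φ d (φ ∘ x) = φ (d x) := by
  simp [LinearMap.apply_eq_sum_smul_single d x, baseChangeMapTo]

theorem exists_apply_single_ne_zero {M : Type} [AddCommGroup M] [Module A M] {n : ℕ}
    {d : (Fin n → A) →ₗ[A] M} (hd : d ≠ 0) : ∃ i, d (Pi.single i 1) ≠ 0 := by
  by_contra! h
  refine hd (LinearMap.pi_ext' fun i => LinearMap.ext_ring ?_)
  simpa using h i

theorem eq_single_of_apply_add_one_eq_zero {w : Fin 2 → U} {i : Fin 2} (hw : w (i + 1) = 0) :
    w = Pi.single i (w i) := by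
  funext j
  fin_cases i <;> fin_cases j <;> simp_all

variable {φ}

/-- A vector of `ker D₀` is determined by a single suitable coordinate. -/
theorem exists_coord_injective_ker_baseChangeMapTo
    (hunit : ∀ a : A, a ≠ 0 → IsUnit (φ a)) {d : (Fin 2 → A) →ₗ[A] A} (hd : d ≠ 0) :
    ∃ j, ∀ w, baseChangeMapTo φ d w = 0 → w j = 0 → w = 0 := by
  obtain ⟨i, hi⟩ := exists_apply_single_ne_zero hd
  refine ⟨i + 1, fun w hw hj => ?_⟩
  rw [eq_single_of_apply_add_one_eq_zero hj] at hw ⊢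
  rw [baseChangeMapTo_single, (hunit _ hi).mul_left_eq_zero] at hw
  simp [hw]

/-- If a vector of `ker f` is determined by one coordinate and `D` is the base change of a nonzero
map with `f ∘ D = 0`, then `D` maps onto `ker f`, and `ker D` has the same property as `ker f`. -/
theorem exact_baseChangeMap_and_exists_coord_injective_ker
    (hφ : Function.Injective φ) (hunit : ∀ a : A, a ≠ 0 → IsUnit (φ a))
    {M : Type} [AddCommGroup M] [Module U M] {f : (Fin 2 → U) →ₗ[U] M}
    (hf : ∃ j, ∀ w, f w = 0 → w j = 0 → w = 0)
    {d : (Fin 2 → A) →ₗ[A] (Fin 2 → A)} (hd : d ≠ 0)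
    (hfd : ∀ i, f (φ ∘ d (Pi.single i 1)) = 0) :
    Function.Exact (baseChangeMap φ d) f ∧
      ∃ j, ∀ w, baseChangeMap φ d w = 0 → w j = 0 → w = 0 := by
  obtain ⟨j, hj⟩ := hf
  obtain ⟨i, hi⟩ := exists_apply_single_ne_zero hd
  have hne : d (Pi.single i 1) j ≠ 0 := fun h0 => hi <| by
    have := hj _ (hfd i) (by simp [h0])
    funext k
    exact hφ (by simpa using congrFun this k)
  have hu := hunit _ hne
  have hcomp : f ∘ₗ baseChangeMap φ d = 0 := by
    refine LinearMap.pi_ext' fun k => LinearMap.ext_ring ?_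
    simp [baseChangeMap_single, hfd]
  refine ⟨fun w => ⟨fun hw => ?_, ?_⟩, i + 1, fun w hw hwi => ?_⟩
  · obtain ⟨v, hv⟩ := hu
    refine ⟨Pi.single i (w j * ↑v⁻¹), ?_⟩
    rw [baseChangeMap_single, eq_comm, ← sub_eq_zero]
    refine hj _ (by simp [hw, hfd]) ?_
    simp [← hv]
  · rintro ⟨u, rfl⟩
    exact LinearMap.congr_fun hcomp u
  · rw [eq_single_of_apply_add_one_eq_zero hwi] at hw ⊢
    rw [baseChangeMap_single] at hw
    have h := congrFun hw j
    rw [Pi.smul_apply, Function.comp_apply, smul_eq_mul, Pi.zero_apply,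
      hu.mul_left_eq_zero] at h
    simp [h]

end BaseChange

/-- Let `Z`, `U` be nonzero rings with `ZG` a subring of `U`
(via an injective ring homomorphism `φ`) such that every nonzero element of
`ZG` becomes invertible in `U`.  Suppose there is an exact sequence of left
`ZG`-modules `⋯ → (ZG)² → (ZG)² → (ZG)² → ZG → Z → 0` (augmentation at the
end) in which all the maps `∂ₖ` are nonzero.  Then applying `U ⊗_{ZG} −` to
the unaugmented complex yields a complex that is exact in every degree; that
is, `H_n(G; U) = 0` for all `n ≥ 0`. -/
theorem homology_vanishes_of_two_generator_two_relator_resolution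
    (G Z U : Type) [Group G] [Ring Z] [Ring U] [Nontrivial Z] [Nontrivial U]
    (φ : MonoidAlgebra Z G →+* U) (hφinj : Function.Injective φ)
    (hunit : ∀ a : MonoidAlgebra Z G, a ≠ 0 → IsUnit (φ a))
    (d0 : (Fin 2 → MonoidAlgebra Z G) →ₗ[MonoidAlgebra Z G] MonoidAlgebra Z G)
    (d : ℕ → ((Fin 2 → MonoidAlgebra Z G) →ₗ[MonoidAlgebra Z G]
        (Fin 2 → MonoidAlgebra Z G)))
    (hd0ne : d0 ≠ 0) (hdne : ∀ k, d k ≠ 0)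
    (hεsurj : Function.Surjective (augmentationLinearMap Z G))
    (hex0 : Function.Exact d0 (augmentationLinearMap Z G))
    (hex1 : Function.Exact (d 0) d0)
    (hexact : ∀ k, Function.Exact (d (k + 1)) (d k)) :
    Function.Surjective (baseChangeMapTo φ d0) ∧
    Function.Exact (baseChangeMap φ (d 0)) (baseChangeMapTo φ d0) ∧
    ∀ k, Function.Exact (baseChangeMap φ (d (k + 1))) (baseChangeMap φ (d k)) := by
  have h0 := exact_baseChangeMap_and_exists_coord_injective_ker hφinj hunit
    (exists_coord_injective_ker_baseChangeMapTo hunit hd0ne) (hdne 0) fun i => by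
      rw [baseChangeMapTo_comp_coe, hex1.apply_apply_eq_zero, map_zero]
  have hstep : ∀ k, (∃ j, ∀ w, baseChangeMap φ (d k) w = 0 → w j = 0 → w = 0) →
      Function.Exact (baseChangeMap φ (d (k + 1))) (baseChangeMap φ (d k)) ∧
        ∃ j, ∀ w, baseChangeMap φ (d (k + 1)) w = 0 → w j = 0 → w = 0 := fun k hk =>
    exact_baseChangeMap_and_exists_coord_injective_ker hφinj hunit hk (hdne _) fun i => by
      rw [baseChangeMap_comp_coe, (hexact k).apply_apply_eq_zero]
      funext
      simp
  have hcoord : ∀ k, ∃ j, ∀ w, baseChangeMap φ (d k) w = 0 → w j = 0 → w = 0 := fun k => by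
    induction k with
    | zero => exact h0.2
    | succ k ih => exact (hstep k ih).2
  refine ⟨fun u => ?_, h0.1, fun k => (hstep k (hcoord k)).1⟩
  obtain ⟨i, hi⟩ := exists_apply_single_ne_zero hd0ne
  obtain ⟨v, hv⟩ := hunit _ hi
  exact ⟨Pi.single i (u * ↑v⁻¹), by simp [baseChangeMapTo_single, ← hv]⟩
end
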